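/- arXiv:2006.11369 — 2 statements merged into one kernel-verified Lean document; each statement's English description precedes it below -/
import Mathlib

section
/- Let H be a connected graph on ℓ ≥ 3 vertices and λ ∈ (0,1/2). There exist constants c, C > 0 depending only on H and λ such that the following holds for all n ≥ v(H) and all integers m with p = m/C(n,2) ∈ (λ,1−λ). Sample G ~ G(n,m) with edge indicators x_e and χ_e = (x_e − p)/√(p(1−p)); expand the subgraph count X_H of H in G as a polynomial in the χ_e, let W_j denote its degree-j part (W_0 and W_2 are deterministic given m), let σ be the standard deviation of W_3 when the χ_e are instead independent normalized Bernoulli(p) variables, and set 𝒦 = (X_H − W_0 − W_2)/σ. Then for all t ∈ ℝ with |t| ≤ π·σ: |E[exp(it·𝒦)]| ≤ C·(exp(−c·n) + exp(−c·t²·n/σ²)). -/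
open MeasureTheory ProbabilityTheory
open scoped ENNReal NNReal

noncomputable section

/-- The uniform probability measure on a subset of a finite type. -/
def finUniform {γ : Type*} [Fintype γ] [MeasurableSpace γ] (s : Set γ) : Measure γ :=
  (Nat.card s : ℝ≥0∞)⁻¹ • ∑ a : γ, s.indicator (fun _ => (1 : ℝ≥0∞)) a • Measure.dirac a

/-- The product Bernoulli(p) measure on `ι → Bool`. -/
def bernoulliPi (ι : Type*) [Fintype ι] [DecidableEq ι] (p : ℝ) : Measure (ι → Bool) :=
  ∑ x : ι → Bool, (∏ i : ι, ENNReal.ofReal (if x i then p else 1 - p)) • Measure.dirac x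

/-- The Erdős–Rényi G(n,p) measure, as a measure on edge-indicator functions. -/
def gnp (n : ℕ) (p : ℝ) : Measure (Sym2 (Fin n) → Bool) := bernoulliPi _ p

/-- The G(n,m) measure: uniform over edge-indicator functions with exactly `m` edges
(diagonal coordinates forced to `false`). -/
def gnm (n m : ℕ) : Measure (Sym2 (Fin n) → Bool) :=
  finUniform {x | (∀ e : Sym2 (Fin n), e.IsDiag → x e = false) ∧
    (Finset.univ.filter fun e : Sym2 (Fin n) => x e = true).card = m}

/-- The simple graph associated to an edge-indicator function. -/
def graphOfFn {n : ℕ} (x : Sym2 (Fin n) → Bool) : SimpleGraph (Fin n) :=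
  SimpleGraph.fromRel fun i j => x s(i, j)

/-- The number of subgraphs of `G` isomorphic to `H`. -/
def subgraphCount {β : Type*} [Fintype β] (H : SimpleGraph β) {n : ℕ}
    (G : SimpleGraph (Fin n)) : ℕ :=
  Nat.card {E : Finset (Sym2 (Fin n)) // ↑E ⊆ G.edgeSet ∧
    ∃ f : β ↪ Fin n, (↑E : Set (Sym2 (Fin n))) = Sym2.map f '' H.edgeSet}

/-- The monomial `χ_E = Π_{e ∈ E} χ_e`, where `χ_e = (x_e − p)/√(p(1−p))`. -/
def chiMono {n : ℕ} (p : ℝ) (E : Finset (Sym2 (Fin n))) (x : Sym2 (Fin n) → Bool) : ℝ :=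
  ∏ e ∈ E, (((if x e then (1 : ℝ) else 0) - p) / Real.sqrt (p * (1 - p)))

open Classical in
/-- The portion of the expansion of `F` in the orthonormal basis `{χ_E}` (with respect to
`G(n,p)`) consisting of the terms whose edge set spans exactly `j` vertices. -/
def orderPart {n : ℕ} (p : ℝ) (j : ℕ) (F : (Sym2 (Fin n) → Bool) → ℝ)
    (x : Sym2 (Fin n) → Bool) : ℝ :=
  ∑ E : Finset (Sym2 (Fin n)),
    if (∀ e ∈ E, ¬ e.IsDiag) ∧
        (Finset.univ.filter fun v : Fin n => ∃ e ∈ E, v ∈ e).card = j then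
      (∫ y, F y * chiMono p E y ∂(gnp n p)) * chiMono p E x
    else 0

end


lemma jensen_norm {α : Type*} [Fintype α] (k : ℝ) (hk : 0 ≤ k) (hk1 : k * Fintype.card α = 1)
    (f : α → ℂ) (n : ℕ) : (k * ‖∑ a, f a‖) ^ n ≤ k * ∑ a, ‖f a‖ ^ n := by
  have h := Real.pow_arith_mean_le_arith_mean_pow (Finset.univ : Finset α) (fun _ => k)
    (fun a => ‖f a‖) (fun _ _ => hk) (by simp; rw [mul_comm]; exact hk1) (fun _ _ => norm_nonneg _) n
  calc (k * ‖∑ a, f a‖) ^ n ≤ (∑ a, k * ‖f a‖) ^ n := by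
        rw [← Finset.mul_sum]
        gcongr
        exact norm_sum_le _ _
    _ ≤ _ := h
    _ = _ := by rw [Finset.mul_sum]

lemma sum_cons {Z : Type*} [Fintype Z] {d : ℕ} {R : Type*} [AddCommMonoid R]
    (f : (Fin (d+1) → Z) → R) :
    ∑ y, f y = ∑ u : Z, ∑ y : Fin d → Z, f (Fin.cons u y) := by
  rw [← Fintype.sum_prod_type']
  exact (Fintype.sum_equiv (Fin.consEquiv (fun _ => Z)) _ _ (fun _ => rfl)).symm

lemma decouple {κ Y : Type*} [Fintype Y] [Nonempty Y] (s : Finset κ) (k : ℝ)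
    (hk1 : k * Fintype.card Y = 1) : ∀ (d : ℕ) (_ : d ≠ 0) (c : κ → ℝ) (g : κ → Fin d → Y → ℝ),
    (k ^ d * ‖∑ y : Fin d → Y, Complex.exp (Complex.I * ((∑ E ∈ s, c E * ∏ j, g E j (y j) : ℝ) : ℂ))‖)
      ^ (2 ^ d) ≤
    (k ^ 2) ^ d * (∑ w : Fin d → Y × Y, Complex.exp (Complex.I *
      ((∑ E ∈ s, c E * ∏ j, (g E j (w j).1 - g E j (w j).2) : ℝ) : ℂ))).re := by
  have hk : 0 ≤ k := by
    by_contra h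
    have : (0:ℝ) ≤ Fintype.card Y := by positivity
    nlinarith
  intro d
  induction d with
  | zero =>
    intro h; exact absurd rfl h
  | succ d ih =>
    intro _ c g
    set a : Y → (Fin d → Y) → ℂ := fun u y =>
      Complex.exp (Complex.I * ((∑ E ∈ s, c E * (g E 0 u * ∏ j : Fin d, g E j.succ (y j)) : ℝ) : ℂ))
      with ha
    have h1 : ∑ y : Fin (d+1) → Y, Complex.exp (Complex.I *
        ((∑ E ∈ s, c E * ∏ j, g E j (y j) : ℝ) : ℂ)) = ∑ y, ∑ u, a u y := by
      rw [sum_cons, Finset.sum_comm]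
      simp [ha, Fin.prod_univ_succ]
    have h2 : ∀ u v y, a u y * (starRingEnd ℂ) (a v y) = Complex.exp (Complex.I *
        ((∑ E ∈ s, (c E * (g E 0 u - g E 0 v)) * ∏ j : Fin d, g E j.succ (y j) : ℝ) : ℂ)) := by
      intro u v y
      simp only [ha]
      rw [← Complex.exp_conj, ← Complex.exp_add]
      congr 1
      rw [map_mul, Complex.conj_I, Complex.conj_ofReal, neg_mul, ← sub_eq_add_neg, ← mul_sub,
        ← Complex.ofReal_sub, ← Finset.sum_sub_distrib]
      congr 2
      exact Finset.sum_congr rfl (fun E _ => by ring)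
    have hY : k ^ d * Fintype.card (Fin d → Y) = 1 := by
      simp [← mul_pow, hk1]
    have hYY : k ^ 2 * Fintype.card (Y × Y) = 1 := by
      rw [Fintype.card_prod]; push_cast; rw [← sq, ← mul_pow, hk1, one_pow]
    have e1 : ∀ y, ‖∑ u, a u y‖ ^ 2 = (∑ q : Y × Y, a q.1 y * (starRingEnd ℂ) (a q.2 y)).re := by
      intro y
      rw [Fintype.sum_prod_type]
      simp only
      rw [← Finset.sum_mul_sum, ← map_sum, Complex.mul_conj, Complex.ofReal_re,
        Complex.normSq_eq_norm_sq]
    have h3 : (k ^ (d+1) * ‖∑ y, ∑ u, a u y‖) ^ 2 ≤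
        k ^ 2 * (k ^ d * (∑ q : Y × Y, ∑ y, a q.1 y * (starRingEnd ℂ) (a q.2 y)).re) := by
      calc (k ^ (d+1) * ‖∑ y, ∑ u, a u y‖) ^ 2 = k ^ 2 * (k ^ d * ‖∑ y, ∑ u, a u y‖) ^ 2 := by ring
        _ ≤ k ^ 2 * (k ^ d * ∑ y, ‖∑ u, a u y‖ ^ 2) := by
          gcongr; exact jensen_norm _ (by positivity) hY _ 2
        _ = k ^ 2 * (k ^ d * (∑ q : Y × Y, ∑ y, a q.1 y * (starRingEnd ℂ) (a q.2 y)).re) := by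
          simp_rw [e1]; rw [← Complex.re_sum, Finset.sum_comm]
    rw [h1, pow_succ' 2 d, pow_mul]
    rcases Nat.eq_zero_or_pos d with hd | hd
    · subst hd
      simp only [pow_zero, pow_one] at h3 ⊢
      refine h3.trans (le_of_eq ?_)
      rw [sum_cons]
      simp only [h2, Nat.reduceAdd, pow_one, one_mul]
      simp
    have h4 : (k ^ (d+1) * ‖∑ y, ∑ u, a u y‖) ^ 2 ≤
        k ^ 2 * ∑ q : Y × Y, k ^ d * ‖∑ y, a q.1 y * (starRingEnd ℂ) (a q.2 y)‖ := by
      refine h3.trans ?_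
      rw [← Finset.mul_sum]
      gcongr
      exact (Complex.re_le_norm _).trans (norm_sum_le _ _)
    calc _ ≤ (k ^ 2 * ∑ q : Y × Y, k ^ d * ‖∑ y, a q.1 y * (starRingEnd ℂ) (a q.2 y)‖) ^ 2 ^ d := by
          gcongr
      _ ≤ k ^ 2 * ∑ q : Y × Y, (k ^ d * ‖∑ y, a q.1 y * (starRingEnd ℂ) (a q.2 y)‖) ^ 2 ^ d := by
          have := Real.pow_arith_mean_le_arith_mean_pow (Finset.univ : Finset (Y × Y)) (fun _ => k ^ 2)
            (fun q => k ^ d * ‖∑ y, a q.1 y * (starRingEnd ℂ) (a q.2 y)‖) (fun _ _ => by positivity)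
            (by rw [Finset.sum_const, nsmul_eq_mul, mul_comm]; exact hYY)
            (fun _ _ => by positivity) (2 ^ d)
          simpa only [← Finset.mul_sum] using this
      _ ≤ k ^ 2 * ∑ q : Y × Y, (k ^ 2) ^ d * (∑ w : Fin d → Y × Y, Complex.exp (Complex.I *
      ((∑ E ∈ s, (c E * (g E 0 q.1 - g E 0 q.2)) * ∏ j, (g E (Fin.succ j) (w j).1 - g E (Fin.succ j) (w j).2) : ℝ) : ℂ))).re := by
          gcongr with q _
          simp_rw [h2]
          exact ih hd.ne' (fun E => c E * (g E 0 q.1 - g E 0 q.2)) (fun E j => g E j.succ)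
      _ = _ := by
          rw [sum_cons, Complex.re_sum, ← Finset.mul_sum, pow_succ' (k ^ 2) d, mul_assoc]
          simp [Fin.prod_univ_succ, mul_assoc]


def swapPerm {N d : ℕ} (z : Fin d → Fin N → Bool) : Equiv.Perm ((Fin N × Fin d) × Bool) :=
  Function.Involutive.toPerm (fun k => (k.1, xor k.2 (z k.1.2 k.1.1)))
    (fun k => by simp)

noncomputable def bval (b : Bool) : ℝ := if b then 1 else 0

noncomputable def polyF {ι : Type*} (𝒞 : Finset (Finset ι)) (x : ι → Bool) : ℝ :=
  ∑ E ∈ 𝒞, ∏ e ∈ E, bval (x e)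

noncomputable def tau {ι : Type*} {N d : ℕ} (φ : (Fin N × Fin d) × Bool ↪ ι)
   (z : Fin d → Fin N → Bool) : Equiv.Perm ι := (swapPerm z).viaEmbedding φ

open Classical in
lemma prod_split {ι : Type*} {N d : ℕ} (φ : (Fin N × Fin d) × Bool ↪ ι) (x : ι → Bool)
    (E : Finset ι) (z : Fin d → Fin N → Bool) :
    ∏ e ∈ E, bval (x (tau φ z e)) = (∏ e ∈ E with e ∉ Set.range φ, bval (x e)) *
      ∏ j, (∏ k : Fin N × Bool, if φ ((k.1, j), k.2) ∈ E then
        bval (x (φ ((k.1, j), xor k.2 (z j k.1)))) else 1) := by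
  have h1 := Finset.prod_filter_mul_prod_filter_not E (fun e => e ∉ Set.range φ)
    (fun e => bval (x (tau φ z e)))
  rw [← h1]
  congr 1
  · refine Finset.prod_congr rfl (fun e he => ?_)
    rw [tau, Equiv.Perm.viaEmbedding_apply_of_notMem]
    exact (Finset.mem_filter.1 he).2
  · have h2 : (E.filter (fun e => ¬ (e ∉ Set.range φ))) =
        (Finset.univ.filter (fun k => φ k ∈ E)).map φ := by
      ext e
      simp only [Finset.mem_filter, Finset.mem_map, not_not, Set.mem_range, Finset.mem_univ, true_and]
      constructor
      · rintro ⟨h, k, rfl⟩; exact ⟨k, h, rfl⟩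
      · rintro ⟨k, h, rfl⟩; exact ⟨h, k, rfl⟩
    rw [h2, Finset.prod_map, Finset.prod_filter, Fintype.prod_prod_type, Fintype.prod_prod_type,
      Finset.prod_comm]
    refine Finset.prod_congr rfl (fun j _ => ?_)
    rw [Fintype.prod_prod_type]
    refine Finset.prod_congr rfl (fun i _ => Finset.prod_congr rfl (fun b _ => ?_))
    rw [tau, Equiv.Perm.viaEmbedding_apply]
    rfl

lemma norm_one_add_exp_le {θ : ℝ} (hθ : |θ| ≤ Real.pi) (a : ℝ) (ha : a = θ ∨ a = -θ) :
    ‖(1:ℂ) + Complex.exp (Complex.I * (a : ℂ))‖ ≤ 2 - θ ^ 2 / Real.pi ^ 2 := by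
  have h1 : (1:ℂ) + Complex.exp (Complex.I * (a : ℂ)) =
      Complex.exp (((a/2 : ℝ):ℂ) * Complex.I) * ((2 * Real.cos (a/2) : ℝ) : ℂ) := by
    push_cast
    rw [Complex.two_cos, mul_add, ← Complex.exp_add, ← Complex.exp_add, add_comm]
    congr 2
    · ring
    · rw [← Complex.exp_zero]; congr 1; ring
  have hsq : a ^ 2 = θ ^ 2 := by rcases ha with rfl | rfl <;> ring
  have habs : |a| ≤ Real.pi := by rcases ha with rfl | rfl <;> simpa using hθ
  have hpi := Real.pi_pos
  have h2 : |a/2| ≤ Real.pi / 2 := by rw [abs_div]; simp; linarith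
  have h3 : 0 ≤ Real.cos (a/2) := Real.cos_nonneg_of_mem_Icc (by
    rw [abs_le] at h2; exact ⟨by linarith [h2.1], h2.2⟩)
  have h4 := Real.cos_le_one_sub_mul_cos_sq (x := a/2) (by linarith)
  rw [h1, norm_mul, Complex.norm_exp_ofReal_mul_I, one_mul, Complex.norm_real, Real.norm_eq_abs,
    abs_of_nonneg (by linarith), ← hsq]
  have : 2 / Real.pi ^ 2 * (a/2)^2 = (a ^ 2 / Real.pi ^ 2) / 2 := by ring
  linarith

lemma gadget_factor {d : ℕ} (hd : d ≠ 0) {θ : ℝ} (hθ : |θ| ≤ Real.pi) (v : Fin d → Bool → Bool)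
    (hv : ∀ j, v j true ≠ v j false) :
    ‖∑ u : Fin d → Bool × Bool, Complex.exp (Complex.I *
      ((θ * ∏ j, (bval (v j (u j).1) - bval (v j (u j).2)) : ℝ) : ℂ))‖ ≤
      4 ^ d - θ ^ 2 / Real.pi ^ 2 := by
  set f : (Fin d → Bool × Bool) → ℂ := fun u => Complex.exp (Complex.I *
      ((θ * ∏ j, (bval (v j (u j).1) - bval (v j (u j).2)) : ℝ) : ℂ)) with hf
  have hn : ∀ u, ‖f u‖ = 1 := by
    intro u; simp only [hf]; rw [mul_comm, Complex.norm_exp_ofReal_mul_I]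
  let u0 : Fin d → Bool × Bool := fun _ => (false, false)
  let u1 : Fin d → Bool × Bool := fun _ => (true, false)
  have hne : u0 ≠ u1 := by
    intro h
    have := congrFun h ⟨0, Nat.pos_of_ne_zero hd⟩
    simp [u0, u1] at this
  have h0 : f u0 = 1 := by
    simp [hf, u0, hd]
  have hP : ∏ j, (bval (v j true) - bval (v j false)) = 1 ∨
      ∏ j, (bval (v j true) - bval (v j false)) = -1 := by
    apply Finset.prod_induction _ (fun r : ℝ => r = 1 ∨ r = -1)
    · rintro a b (rfl | rfl) (rfl | rfl) <;> simp
    · simp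
    · intro j _
      have := hv j
      revert this
      cases v j true <;> cases v j false <;> simp [bval]
  have h1 : ‖f u0 + f u1‖ ≤ 2 - θ ^ 2 / Real.pi ^ 2 := by
    rw [h0]
    apply norm_one_add_exp_le hθ
    simp only [u1]
    rcases hP with h | h <;> rw [h] <;> simp
  have hcard : Fintype.card (Fin d → Bool × Bool) = 4 ^ d := by simp
  rw [← Finset.add_sum_erase _ f (Finset.mem_univ u0),
    ← Finset.add_sum_erase _ f (a := u1) (by simp [hne.symm]), ← add_assoc]
  refine (norm_add_le _ _).trans ?_
  have h5 : ‖∑ x ∈ (Finset.univ.erase u0).erase u1, f x‖ ≤ 4 ^ d - 2 := by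
    refine (norm_sum_le _ _).trans ?_
    simp only [hn, Finset.sum_const, nsmul_eq_mul, mul_one]
    rw [Finset.card_erase_of_mem (by simp [hne.symm]), Finset.card_erase_of_mem (by simp),
      Finset.card_univ, hcard]
    have : 4 ≤ 4 ^ d := Nat.le_self_pow hd 4
    rw [Nat.sub_sub, Nat.cast_sub (by omega)]
    norm_num
  linarith

def pairEquiv (N d : ℕ) : (Fin d → (Fin N → Bool) × (Fin N → Bool)) ≃ (Fin N → Fin d → Bool × Bool) where
  toFun w i j := ((w j).1 i, (w j).2 i)
  invFun u j := (fun i => (u i j).1, fun i => (u i j).2)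
  left_inv _ := rfl
  right_inv _ := rfl

lemma gadget_sum {N d : ℕ} (hd : d ≠ 0) {θ : ℝ} (hθ : |θ| ≤ Real.pi)
    (v : Fin N → Fin d → Bool → Bool) :
    ((((2:ℝ) ^ N)⁻¹) ^ 2) ^ d * (∑ w : Fin d → (Fin N → Bool) × (Fin N → Bool), Complex.exp (Complex.I *
      ((∑ i, θ * ∏ j, (bval (v i j ((w j).1 i)) - bval (v i j ((w j).2 i))) : ℝ) : ℂ))).re ≤
    Real.exp (-(θ ^ 2 / (4 ^ d * Real.pi ^ 2) *
      (Finset.univ.filter (fun i => ∀ j, v i j true ≠ v i j false)).card)) := by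
  have h1 : (∑ w : Fin d → (Fin N → Bool) × (Fin N → Bool), Complex.exp (Complex.I *
      ((∑ i, θ * ∏ j, (bval (v i j ((w j).1 i)) - bval (v i j ((w j).2 i))) : ℝ) : ℂ))) =
      ∏ i, ∑ u : Fin d → Bool × Bool, Complex.exp (Complex.I *
      ((θ * ∏ j, (bval (v i j (u j).1) - bval (v i j (u j).2)) : ℝ) : ℂ)) := by
    rw [Finset.prod_univ_sum, Fintype.piFinset_univ]
    refine Fintype.sum_equiv (pairEquiv N d) _ _ (fun w => ?_)
    rw [← Complex.exp_sum, ← Finset.mul_sum Finset.univ _ Complex.I, Complex.ofReal_sum]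
    rfl
  have h2 : ((((2:ℝ) ^ N)⁻¹) ^ 2) ^ d = ∏ i : Fin N, ((4:ℝ) ^ d)⁻¹ := by
    rw [Finset.prod_const, Finset.card_univ, Fintype.card_fin]
    rw [← inv_pow, ← pow_mul, ← pow_mul, ← inv_pow, ← pow_mul, show (4:ℝ)⁻¹ = 2⁻¹ ^ 2 by norm_num, ← pow_mul]
    congr 1; ring
  rw [h1, h2]
  have hp : (0:ℝ) < 4 ^ d := by positivity
  calc _ ≤ (∏ i : Fin N, ((4:ℝ) ^ d)⁻¹) * ‖∏ i, ∑ u : Fin d → Bool × Bool, Complex.exp (Complex.I *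
      ((θ * ∏ j, (bval (v i j (u j).1) - bval (v i j (u j).2)) : ℝ) : ℂ))‖ := by
        gcongr; exact Complex.re_le_norm _
    _ = ∏ i, (((4:ℝ) ^ d)⁻¹ * ‖∑ u : Fin d → Bool × Bool, Complex.exp (Complex.I *
      ((θ * ∏ j, (bval (v i j (u j).1) - bval (v i j (u j).2)) : ℝ) : ℂ))‖) := by
        rw [norm_prod, Finset.prod_mul_distrib]
    _ ≤ ∏ i, (if ∀ j, v i j true ≠ v i j false then Real.exp (-(θ ^ 2 / (4 ^ d * Real.pi ^ 2))) else 1) := by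
        apply Finset.prod_le_prod
        · intro i _; positivity
        · intro i _
          split_ifs with hg
          · have h3 := gadget_factor hd hθ (v i) hg
            calc _ ≤ ((4:ℝ) ^ d)⁻¹ * (4 ^ d - θ ^ 2 / Real.pi ^ 2) := by gcongr
              _ = -(θ ^ 2 / (4 ^ d * Real.pi ^ 2)) + 1 := by
                have := Real.pi_pos; field_simp; ring
              _ ≤ _ := Real.add_one_le_exp _
          · rw [inv_mul_le_iff₀ hp, mul_one]
            refine (norm_sum_le _ _).trans ?_
            simp_rw [mul_comm Complex.I, Complex.norm_exp_ofReal_mul_I]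
            simp
    _ = _ := by
        rw [Finset.prod_ite, Finset.prod_const, Finset.prod_const_one, mul_one, ← Real.exp_nat_mul]
        congr 1; ring

open Classical in
lemma core {ι : Type*} {N d : ℕ} (hd : d ≠ 0) (φ : (Fin N × Fin d) × Bool ↪ ι)
    (𝒞 : Finset (Finset ι))
    (hc1 : ∀ i, Finset.univ.image (fun j => φ ((i, j), false)) ∈ 𝒞)
    (hc2 : ∀ E ∈ 𝒞, (∀ j, ∃ i b, φ ((i, j), b) ∈ E) →
      ∃ i, E = Finset.univ.image (fun j => φ ((i, j), false)))
    {θ : ℝ} (hθ : |θ| ≤ Real.pi) (x : ι → Bool) :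
    (((2:ℝ) ^ N)⁻¹) ^ d * ‖∑ z : Fin d → Fin N → Bool,
      Complex.exp (Complex.I * ((θ * polyF 𝒞 (fun e => x (tau φ z e)) : ℝ) : ℂ))‖ ≤
    Real.exp (-(θ ^ 2 / (8 ^ d * Real.pi ^ 2) *
      (Finset.univ.filter (fun i => ∀ j, x (φ ((i, j), true)) ≠ x (φ ((i, j), false)))).card)) := by
  set c : Finset ι → ℝ := fun E => θ * ∏ e ∈ E with e ∉ Set.range φ, bval (x e) with hc
  set g : Finset ι → Fin d → (Fin N → Bool) → ℝ := fun E j y =>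
    ∏ k : Fin N × Bool, if φ ((k.1, j), k.2) ∈ E then
        bval (x (φ ((k.1, j), xor k.2 (y k.1)))) else 1 with hg
  have hdec := decouple 𝒞 (((2:ℝ) ^ N)⁻¹) (Y := Fin N → Bool) (by simp) d hd c g
  have h1 : ∀ z : Fin d → Fin N → Bool, θ * polyF 𝒞 (fun e => x (tau φ z e)) =
      ∑ E ∈ 𝒞, c E * ∏ j, g E j (z j) := by
    intro z
    rw [polyF, Finset.mul_sum]
    refine Finset.sum_congr rfl (fun E _ => ?_)
    rw [prod_split, mul_assoc]
  simp_rw [h1]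
  set im : Fin N → Finset ι := fun i => Finset.univ.image (fun j => φ ((i, j), false)) with him
  have hmem : ∀ i i' j b, φ ((i', j), b) ∈ im i ↔ i' = i ∧ b = false := by
    intro i i' j b
    simp only [him, Finset.mem_image, Finset.mem_univ, true_and, EmbeddingLike.apply_eq_iff_eq,
      Prod.mk.injEq]
    constructor
    · rintro ⟨j', ⟨h1, h2⟩, h3⟩; exact ⟨h1.symm, h3.symm⟩
    · rintro ⟨rfl, rfl⟩; exact ⟨j, ⟨rfl, rfl⟩, rfl⟩
  have hinj : Function.Injective im := by
    intro i i' h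
    have := (hmem i i ⟨0, Nat.pos_of_ne_zero hd⟩ false).2 ⟨rfl, rfl⟩
    rw [h, hmem] at this
    exact this.1
  have hgim : ∀ i j y, g (im i) j y = bval (x (φ ((i, j), y i))) := by
    intro i j y
    simp only [hg, hmem]
    rw [Finset.prod_eq_single (i, false)]
    · simp
    · rintro ⟨i', b⟩ _ hne
      rw [if_neg]
      rintro ⟨h1, h2⟩
      simp only at h1 h2
      exact hne (by rw [h1, h2])
    · simp
  have hcim : ∀ i, c (im i) = θ := by
    intro i
    simp only [hc]
    rw [Finset.prod_eq_one, mul_one]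
    intro e he
    rw [Finset.mem_filter] at he
    obtain ⟨j, -, rfl⟩ := Finset.mem_image.1 he.1
    exact absurd ⟨_, rfl⟩ he.2
  have h2 : ∀ w : Fin d → (Fin N → Bool) × (Fin N → Bool),
      ∑ E ∈ 𝒞, c E * ∏ j, (g E j (w j).1 - g E j (w j).2) =
      ∑ i, θ * ∏ j, (bval (x (φ ((i, j), (w j).1 i))) - bval (x (φ ((i, j), (w j).2 i)))) := by
    intro w
    rw [← Finset.sum_subset (s₁ := Finset.univ.image im)]
    · rw [Finset.sum_image (fun a _ b _ h => hinj h)]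
      simp_rw [hgim, hcim]
    · intro E hE
      obtain ⟨i, -, rfl⟩ := Finset.mem_image.1 hE
      exact hc1 i
    · intro E hE hne
      have : ∃ j, ∀ i b, φ ((i, j), b) ∉ E := by
        by_contra hcon
        push Not at hcon
        obtain ⟨i, hi⟩ := hc2 E hE hcon
        exact hne (Finset.mem_image.2 ⟨i, Finset.mem_univ _, hi.symm⟩)
      obtain ⟨j, hj⟩ := this
      rw [Finset.prod_eq_zero (Finset.mem_univ j), mul_zero]
      simp [hg, hj]
  simp_rw [h2] at hdec
  have h3 := hdec.trans (gadget_sum hd hθ (fun i j b => x (φ ((i, j), b))))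
  have hpi := Real.pi_pos
  refine le_of_pow_le_pow_left₀ (n := 2 ^ d) (by positivity) (Real.exp_nonneg _) (h3.trans (le_of_eq ?_))
  rw [← Real.exp_nat_mul]
  congr 1
  rw [show (8:ℝ) = 2 * 4 by norm_num, mul_pow]
  push_cast
  field_simp

lemma fact_pow_le (m k : ℕ) : m.factorial * m ^ k ≤ k.factorial * m ^ m := by
  rcases le_total m k with h | h
  · obtain ⟨r, rfl⟩ := Nat.exists_eq_add_of_le h
    rw [pow_add]
    have h1 : m.factorial * m ^ r ≤ (m + r).factorial := by
      refine le_trans ?_ (Nat.factorial_mul_pow_le_factorial (m := m) (n := r))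
      gcongr; omega
    calc _ = (m.factorial * m ^ r) * m ^ m := by ring
      _ ≤ _ := by gcongr
  · obtain ⟨r, rfl⟩ := Nat.exists_eq_add_of_le h
    have h1 : (k + r).factorial ≤ k.factorial * (k + r) ^ r := by
      have h2 := Nat.factorial_mul_descFactorial (n := k + r) (k := r) (by omega)
      rw [Nat.add_sub_cancel] at h2
      rw [← h2]
      gcongr
      exact Nat.descFactorial_le_pow _ _
    calc _ ≤ (k.factorial * (k + r) ^ r) * (k+r) ^ k := by gcongr
      _ = _ := by rw [pow_add (k+r) k r]; ring

lemma mode_bound (M m : ℕ) (hm : m ≤ M) (hM : 0 < M) :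
    1 ≤ ((M:ℝ) + 1) * (M.choose m * ((m:ℝ) / M) ^ m * (1 - (m:ℝ) / M) ^ (M - m)) := by
  have hMr : (0:ℝ) < M := by exact_mod_cast hM
  have hq : 1 - (m:ℝ) / M = ((M - m : ℕ) : ℝ) / M := by
    rw [Nat.cast_sub hm]; field_simp
  have key : ∀ k ≤ M, ((m:ℝ) / M) ^ k * (1 - (m:ℝ) / M) ^ (M - k) * M.choose k ≤
      M.choose m * ((m:ℝ) / M) ^ m * (1 - (m:ℝ) / M) ^ (M - m) := by
    intro k hk
    rw [hq]
    have h1 := fact_pow_le m k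
    have h2 := fact_pow_le (M - m) (M - k)
    have h3 := Nat.mul_le_mul h1 h2
    have e1 := Nat.choose_mul_factorial_mul_factorial hm
    have e2 := Nat.choose_mul_factorial_mul_factorial hk
    have h4 : m ^ k * (M - m) ^ (M - k) * M.choose k ≤ M.choose m * (m ^ m * (M - m) ^ (M - m)) := by
      have hpos : 0 < m.factorial * (M-m).factorial * (k.factorial * (M-k).factorial) := by positivity
      refine le_of_mul_le_mul_left ?_ hpos
      calc _ = (m.factorial * m ^ k * ((M - m).factorial * (M - m) ^ (M - k))) *
            (M.choose k * k.factorial * (M-k).factorial) := by ring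
        _ ≤ (k.factorial * m ^ m * ((M - k).factorial * (M - m) ^ (M - m))) *
            (M.choose k * k.factorial * (M-k).factorial) := by gcongr
        _ = (k.factorial * m ^ m * ((M - k).factorial * (M - m) ^ (M - m))) *
            (M.choose m * m.factorial * (M-m).factorial) := by rw [e1, e2]
        _ = _ := by ring
    have h5 : ((m ^ k * (M - m) ^ (M - k) * M.choose k : ℕ) : ℝ) ≤
      ((M.choose m * (m ^ m * (M - m) ^ (M - m)) : ℕ) : ℝ) := by exact_mod_cast h4
    simp only [Nat.cast_mul, Nat.cast_pow] at h5
    have f1 : ((m:ℝ) / M) ^ k * (((M - m : ℕ) : ℝ) / M) ^ (M - k) * M.choose k =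
      ((m:ℝ) ^ k * ((M - m : ℕ):ℝ) ^ (M - k) * M.choose k) / M ^ M := by
      rw [div_pow, div_pow, div_mul_div_comm, ← pow_add, Nat.add_sub_cancel' hk]; ring
    have f2 : M.choose m * ((m:ℝ) / M) ^ m * (((M - m : ℕ) : ℝ) / M) ^ (M - m) =
      (M.choose m * ((m:ℝ) ^ m * ((M - m : ℕ):ℝ) ^ (M - m))) / M ^ M := by
      rw [mul_assoc, div_pow, div_pow, div_mul_div_comm, ← pow_add, Nat.add_sub_cancel' hm]; ring
    rw [f1, f2]
    gcongr
  have h1 : (1:ℝ) = ∑ k ∈ Finset.range (M+1), ((m:ℝ) / M) ^ k * (1 - (m:ℝ) / M) ^ (M - k) * M.choose k := by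
    rw [← add_pow]; simp
  refine h1.le.trans ?_
  refine (Finset.sum_le_card_nsmul _ _ _ (fun k hk => key k (by simpa [Nat.lt_succ_iff] using hk))).trans ?_
  simp

section
variable {ι : Type*} [Fintype ι] [DecidableEq ι]

noncomputable def wt (p : ℝ) (D : Finset ι) (e : ι) (b : Bool) : ℝ :=
  if e ∈ D then (if b then p else 1 - p) else (if b then 0 else 1)

def slice (D : Finset ι) (m : ℕ) : Finset (ι → Bool) :=
  Finset.univ.filter (fun x => (∀ e, e ∉ D → x e = false) ∧
    (Finset.univ.filter (fun e => x e = true)).card = m)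

lemma wt_slice (p : ℝ) (D : Finset ι) (m : ℕ) (x : ι → Bool) (hx : x ∈ slice D m) :
    ∏ e, wt p D e (x e) = p ^ m * (1 - p) ^ (D.card - m) := by
  simp only [slice, Finset.mem_filter, Finset.mem_univ, true_and] at hx
  obtain ⟨h1, h2⟩ := hx
  have hf : D.filter (fun e => x e = true) = Finset.univ.filter (fun e => x e = true) := by
    ext e
    simp only [Finset.mem_filter, Finset.mem_univ, true_and, and_iff_right_iff_imp]
    intro he
    by_contra hD
    rw [h1 e hD] at he
    cases he
  have hf2 := Finset.card_filter_add_card_filter_not (s := D) (fun e => x e = true)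
  rw [← Finset.prod_subset (Finset.subset_univ D)]
  · rw [Finset.prod_congr rfl (g := fun e => if x e = true then p else 1 - p)
      (fun e he => by simp [wt, he])]
    rw [Finset.prod_ite, Finset.prod_const, Finset.prod_const]
    rw [hf, h2] at hf2
    rw [hf, h2]
    congr 2
    omega
  · intro e _ he
    simp [wt, he, h1 e he]

lemma card_slice (D : Finset ι) (m : ℕ) : (slice D m).card = D.card.choose m := by
  rw [← Finset.card_powersetCard]
  refine Finset.card_nbij' (fun x => Finset.univ.filter (fun e => x e = true))
    (fun s e => decide (e ∈ s)) ?_ ?_ ?_ ?_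
  · intro x hx
    simp only [slice, Finset.coe_filter, Set.mem_ofPred_eq, Finset.mem_univ, true_and] at hx
    simp only [Finset.mem_coe, Finset.mem_powersetCard]
    refine ⟨?_, hx.2⟩
    intro e he
    by_contra hD
    simp [hx.1 e hD] at he
  · intro s hs
    simp only [Finset.mem_coe, Finset.mem_powersetCard] at hs
    simp only [slice, Finset.coe_filter, Set.mem_ofPred_eq, Finset.mem_univ, true_and]
    refine ⟨fun e he => ?_, ?_⟩
    · simp only [decide_eq_false_iff_not]; exact fun h => he (hs.1 h)
    · simpa using hs.2
  · intro x _; ext e; simp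
  · intro s _; ext e; simp

lemma marginal {B : Type*} [Fintype B] [DecidableEq B] (φ : B ↪ ι) (w : ι → Bool → ℝ)
    (hw : ∀ e, w e true + w e false = 1) (G : (B → Bool) → ℝ) :
    ∑ x : ι → Bool, (∏ e, w e (x e)) * G (fun b => x (φ b)) =
      ∑ y : B → Bool, (∏ b, w (φ b) (y b)) * G y := by
  have h1 : ∀ x : ι → Bool, G (fun b => x (φ b)) =
      ∑ y : B → Bool, (∏ b, if x (φ b) = y b then (1:ℝ) else 0) * G y := by
    intro x
    rw [Finset.sum_eq_single (fun b => x (φ b))]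
    · simp
    · intro y _ hy
      obtain ⟨b, hb⟩ := Function.ne_iff.1 hy
      rw [Finset.prod_eq_zero (Finset.mem_univ b), zero_mul]
      rw [if_neg (fun h => hb h.symm)]
    · simp
  simp_rw [h1, Finset.mul_sum]
  rw [Finset.sum_comm]
  refine Finset.sum_congr rfl (fun y _ => ?_)
  simp_rw [← mul_assoc, ← Finset.sum_mul]
  congr 1
  have h2 : ∀ x : ι → Bool, (∏ e, w e (x e)) * (∏ b, if x (φ b) = y b then (1:ℝ) else 0) =
      ∏ e, (w e (x e) * (if ∀ b, φ b = e → x e = y b then 1 else 0)) := by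
    intro x
    rw [Finset.prod_mul_distrib]
    congr 1
    rw [← Finset.prod_subset (Finset.subset_univ (Finset.univ.map φ)), Finset.prod_map]
    · refine Finset.prod_congr rfl (fun b _ => ?_)
      congr 1
      simp
    · intro e _ he
      rw [if_pos]
      rintro b rfl
      exact absurd (Finset.mem_map_of_mem φ (Finset.mem_univ b)) he
  simp_rw [h2]
  rw [← Fintype.piFinset_univ, ← Finset.prod_univ_sum (fun _ => Finset.univ)
    (fun e b' => w e b' * (if ∀ b, φ b = e → b' = y b then 1 else 0))]
  rw [← Finset.prod_subset (Finset.subset_univ (Finset.univ.map φ)), Finset.prod_map]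
  · refine Finset.prod_congr rfl (fun b _ => ?_)
    simp
  · intro e _ he
    have : ∀ b', ∀ b, φ b = e → b' = y b := by
      rintro b' b rfl
      exact absurd (Finset.mem_map_of_mem φ (Finset.mem_univ b)) he
    simp only [Fintype.sum_bool]
    rw [if_pos (this true), if_pos (this false), mul_one, mul_one, hw]

def blockEquiv (N d : ℕ) : ((Fin N × Fin d) × Bool → Bool) ≃ (Fin N → Fin d → Bool → Bool) where
  toFun y i j b := y ((i, j), b)
  invFun u k := u k.1.1 k.1.2 k.2
  left_inv _ := rfl
  right_inv _ := rfl

lemma block_sum {d : ℕ} {lam p : ℝ} (hlam : 0 < lam) (hp : lam ≤ p) (hp' : p ≤ 1 - lam) :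
    ∑ u : Fin d → Bool → Bool, (∏ j, ∏ b, (if u j b then p else 1 - p)) *
      (if ∀ j, u j true ≠ u j false then (1/2 : ℝ) else 1) ≤ 1 - lam ^ (2 * d) / 2 := by
  have h1 : ∑ u : Fin d → Bool → Bool, (∏ j, ∏ b, (if u j b then p else 1 - p)) = 1 := by
    have h2 : ∑ f : Bool → Bool, ∏ b, (if f b then p else 1 - p) = 1 := by
      rw [← Fintype.piFinset_univ, ← Finset.prod_univ_sum (fun _ => Finset.univ)
        (fun _ b' => if b' = true then p else 1 - p)]
      simp
    rw [← Fintype.piFinset_univ, ← Finset.prod_univ_sum (fun _ => Finset.univ)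
        (fun _ (f : Bool → Bool) => ∏ b, (if f b then p else 1 - p))]
    simp only [h2, Finset.prod_const_one]
  have hpos : ∀ u : Fin d → Bool → Bool, 0 ≤ ∏ j, ∏ b, (if u j b then p else 1 - p) := by
    intro u
    refine Finset.prod_nonneg (fun j _ => Finset.prod_nonneg (fun b _ => ?_))
    split_ifs <;> linarith
  have h3 : ∀ u : Fin d → Bool → Bool, (∏ j, ∏ b, (if u j b then p else 1 - p)) *
      (if ∀ j, u j true ≠ u j false then (1/2 : ℝ) else 1) =
      (∏ j, ∏ b, (if u j b then p else 1 - p)) - (∏ j, ∏ b, (if u j b then p else 1 - p)) *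
      (if ∀ j, u j true ≠ u j false then (1/2 : ℝ) else 0) := by
    intro u; split_ifs <;> ring
  simp_rw [h3]
  rw [Finset.sum_sub_distrib, h1]
  have h4 := Finset.single_le_sum (s := Finset.univ) (f := fun u : Fin d → Bool → Bool =>
      (∏ j, ∏ b, (if u j b then p else 1 - p)) *
      (if ∀ j, u j true ≠ u j false then (1/2 : ℝ) else 0))
      (fun u _ => mul_nonneg (hpos u) (by split_ifs <;> norm_num)) (Finset.mem_univ (fun _ b => b))
  have h5 : lam ^ (2 * d) / 2 ≤ (∏ j : Fin d, ∏ b : Bool, (if b then p else 1 - p)) *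
      (if ∀ j : Fin d, true ≠ false then (1/2 : ℝ) else 0) := by
    simp only [Fintype.prod_bool]
    simp only [Finset.prod_const, Finset.card_univ, Fintype.card_fin]
    simp only [ne_eq, Bool.true_eq_false, not_false_eq_true, implies_true, if_true]
    rw [pow_mul, div_eq_mul_one_div]
    gcongr
    simp only [Bool.false_eq_true, if_false]
    nlinarith
  linarith

noncomputable def good {N d : ℕ} (φ : (Fin N × Fin d) × Bool ↪ ι) (x : ι → Bool) : ℕ :=
  (Finset.univ.filter (fun i => ∀ j, x (φ ((i, j), true)) ≠ x (φ ((i, j), false)))).card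

lemma wt_sum (p : ℝ) (D : Finset ι) (e : ι) : wt p D e true + wt p D e false = 1 := by
  simp only [wt]; split_ifs <;> simp_all

lemma gnp_good {N d : ℕ} (φ : (Fin N × Fin d) × Bool ↪ ι) (D : Finset ι) (hφ : ∀ k, φ k ∈ D)
    {lam p : ℝ} (hlam : 0 < lam) (hp : lam ≤ p) (hp' : p ≤ 1 - lam) :
    ∑ x : ι → Bool, (∏ e, wt p D e (x e)) * (1/2 : ℝ) ^ good φ x ≤ (1 - lam ^ (2 * d) / 2) ^ N := by
  have h1 := marginal φ (wt p D) (wt_sum p D) (fun y => (1/2 : ℝ) ^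
    (Finset.univ.filter (fun i : Fin N => ∀ j : Fin d, y ((i, j), true) ≠ y ((i, j), false))).card)
  refine h1.le.trans ?_
  have h2 : ∑ y : (Fin N × Fin d) × Bool → Bool, (∏ b, wt p D (φ b) (y b)) * (1/2 : ℝ) ^
    (Finset.univ.filter (fun i : Fin N => ∀ j : Fin d, y ((i, j), true) ≠ y ((i, j), false))).card
    = ∏ i : Fin N, ∑ u : Fin d → Bool → Bool, (∏ j, ∏ b, (if u j b then p else 1 - p)) *
      (if ∀ j, u j true ≠ u j false then (1/2 : ℝ) else 1) := by
    rw [Finset.prod_univ_sum, Fintype.piFinset_univ]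
    refine Fintype.sum_equiv (blockEquiv N d) _ _ (fun y => ?_)
    rw [Finset.prod_mul_distrib]
    congr 1
    · rw [Fintype.prod_prod_type, Fintype.prod_prod_type]
      refine Finset.prod_congr rfl (fun i _ => Finset.prod_congr rfl (fun j _ =>
        Finset.prod_congr rfl (fun b _ => ?_)))
      simp only [wt, hφ, if_true]
      rfl
    · rw [Finset.prod_ite, Finset.prod_const, Finset.prod_const_one, mul_one]
      rfl
  rw [h2, Finset.prod_const, Finset.card_univ, Fintype.card_fin]
  refine pow_le_pow_left₀ (Finset.sum_nonneg (fun u _ => mul_nonneg ?_ ?_))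
    (block_sum hlam hp hp') N
  · refine Finset.prod_nonneg (fun j _ => Finset.prod_nonneg (fun b _ => ?_))
    split_ifs <;> linarith
  · split_ifs <;> norm_num

open Classical in
lemma bad_bound {N d : ℕ} (φ : (Fin N × Fin d) × Bool ↪ ι) (D : Finset ι) (hφ : ∀ k, φ k ∈ D)
    (m : ℕ) (hD : 0 < D.card)
    {lam : ℝ} (hlam : 0 < lam) (hp : lam ≤ (m : ℝ) / D.card) (hp' : (m : ℝ) / D.card ≤ 1 - lam)
    (T : ℝ) :
    (((slice D m).filter (fun x => (good φ x : ℝ) < T)).card : ℝ) ≤ (slice D m).card *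
      (((D.card : ℝ) + 1) * (Real.exp (T * Real.log 2) * (1 - lam ^ (2 * d) / 2) ^ N)) := by
  set p := (m : ℝ) / D.card with hpdef
  have hDr : (0:ℝ) < D.card := by exact_mod_cast hD
  have hm : m ≤ D.card := by
    have : p ≤ 1 := by linarith
    rw [hpdef, div_le_one hDr] at this
    exact_mod_cast this
  set q := p ^ m * (1 - p) ^ (D.card - m) with hq
  have hq0 : 0 < q := by
    have : 0 < p := by linarith
    have : 0 < 1 - p := by linarith
    positivity
  have h1 : 1 ≤ ((D.card : ℝ) + 1) * ((slice D m).card * q) := by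
    have := mode_bound D.card m hm hD
    rw [card_slice, hq, ← mul_assoc (D.card.choose m : ℝ)]; exact this
  have h2 : (((slice D m).filter (fun x => (good φ x : ℝ) < T)).card : ℝ) * q ≤
      Real.exp (T * Real.log 2) * (1 - lam ^ (2 * d) / 2) ^ N := by
    calc _ = ∑ x ∈ (slice D m).filter (fun x => (good φ x : ℝ) < T), q := by simp
      _ ≤ ∑ x ∈ (slice D m).filter (fun x => (good φ x : ℝ) < T),
          Real.exp (T * Real.log 2) * ((∏ e, wt p D e (x e)) * (1/2 : ℝ) ^ good φ x) := by
        refine Finset.sum_le_sum (fun x hx => ?_)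
        rw [Finset.mem_filter] at hx
        rw [wt_slice p D m x hx.1, ← hq, mul_left_comm]
        refine le_mul_of_one_le_right hq0.le ?_
        have : (1/2 : ℝ) ^ good φ x = Real.exp (-(good φ x * Real.log 2)) := by
          rw [Real.exp_neg, Real.exp_nat_mul, Real.exp_log (by norm_num)]; simp
        rw [this, ← Real.exp_add, Real.one_le_exp_iff]
        have := Real.log_pos (x := 2) (by norm_num)
        nlinarith [hx.2]
      _ ≤ ∑ x, Real.exp (T * Real.log 2) * ((∏ e, wt p D e (x e)) * (1/2 : ℝ) ^ good φ x) := by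
        refine Finset.sum_le_sum_of_subset_of_nonneg (Finset.subset_univ _) (fun x _ _ => ?_)
        refine mul_nonneg (Real.exp_nonneg _) (mul_nonneg (Finset.prod_nonneg (fun e _ => ?_)) (by positivity))
        simp only [wt]
        split_ifs <;> linarith
      _ ≤ _ := by
        rw [← Finset.mul_sum]
        gcongr
        exact gnp_good φ D hφ hlam hp hp'
  set b := (((slice D m).filter (fun x => (good φ x : ℝ) < T)).card : ℝ) with hb
  have hb0 : 0 ≤ b := by positivity
  calc b ≤ b * (((D.card : ℝ) + 1) * ((slice D m).card * q)) := le_mul_of_one_le_right hb0 h1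
    _ = ((D.card : ℝ) + 1) * (slice D m).card * (b * q) := by ring
    _ ≤ ((D.card : ℝ) + 1) * (slice D m).card * (Real.exp (T * Real.log 2) * (1 - lam ^ (2 * d) / 2) ^ N) := by
      gcongr
    _ = _ := by ring

end

section
variable {ι : Type*} [Fintype ι] [DecidableEq ι]

lemma slice_tau_sum {N d : ℕ} (φ : (Fin N × Fin d) × Bool ↪ ι) (D : Finset ι) (hφ : ∀ k, φ k ∈ D)
    (m : ℕ) (z : Fin d → Fin N → Bool) (f : (ι → Bool) → ℂ) :
    ∑ x ∈ slice D m, f (fun e => x (tau φ z e)) = ∑ x ∈ slice D m, f x := by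
  refine Finset.sum_equiv ((tau φ z).symm.arrowCongr (Equiv.refl Bool)) (fun x => ?_) (fun x _ => ?_)
  · have h1 : ∀ e, e ∉ D → tau φ z e = e := by
      intro e he
      rw [tau, Equiv.Perm.viaEmbedding_apply_of_notMem]
      rintro ⟨k, rfl⟩
      exact he (hφ k)
    simp only [slice, Finset.mem_filter, Finset.mem_univ, true_and]
    refine and_congr ?_ ?_
    · refine forall_congr' (fun e => forall_congr' (fun he => ?_))
      simp [h1 e he]
    · have : (Finset.univ.filter (fun e => x e = true)).card = (Finset.univ.filter (fun e =>
        ((tau φ z).symm.arrowCongr (Equiv.refl Bool)) x e = true)).card := by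
        refine Finset.card_equiv (tau φ z).symm (fun e => ?_)
        simp
      rw [this]
  · rfl

lemma slice_bound {N d : ℕ} (hd : d ≠ 0) (φ : (Fin N × Fin d) × Bool ↪ ι)
    (D : Finset ι) (hφ : ∀ k, φ k ∈ D) (𝒞 : Finset (Finset ι))
    (hc1 : ∀ i, Finset.univ.image (fun j => φ ((i, j), false)) ∈ 𝒞)
    (hc2 : ∀ E ∈ 𝒞, (∀ j, ∃ i b, φ ((i, j), b) ∈ E) →
      ∃ i, E = Finset.univ.image (fun j => φ ((i, j), false)))
    (m : ℕ) (hD : 0 < D.card)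
    {lam : ℝ} (hlam : 0 < lam) (hp : lam ≤ (m : ℝ) / D.card) (hp' : (m : ℝ) / D.card ≤ 1 - lam)
    {θ : ℝ} (hθ : |θ| ≤ Real.pi) (T : ℝ) :
    ‖∑ x ∈ slice D m, Complex.exp (Complex.I * ((θ * polyF 𝒞 x : ℝ) : ℂ))‖ ≤
      (slice D m).card *
      (((D.card : ℝ) + 1) * (Real.exp (T * Real.log 2) * (1 - lam ^ (2 * d) / 2) ^ N) +
        Real.exp (-(θ ^ 2 / (8 ^ d * Real.pi ^ 2) * T))) := by
  classical
  set k : ℝ := (((2:ℝ) ^ N)⁻¹) ^ d with hk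
  have hk0 : 0 ≤ k := by positivity
  have hk1 : k * Fintype.card (Fin d → Fin N → Bool) = 1 := by
    simp only [hk, Fintype.card_fun, Fintype.card_fin, Fintype.card_bool]
    push_cast
    rw [← mul_pow, inv_mul_cancel₀ (by positivity), one_pow]
  set f : (ι → Bool) → ℂ := fun x => Complex.exp (Complex.I * ((θ * polyF 𝒞 x : ℝ) : ℂ)) with hf
  have h1 : ∑ x ∈ slice D m, f x = ∑ x ∈ slice D m, ((k:ℝ):ℂ) * ∑ z : Fin d → Fin N → Bool,
      f (fun e => x (tau φ z e)) := by
    rw [← Finset.mul_sum, Finset.sum_comm]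
    simp_rw [slice_tau_sum φ D hφ m _ f]
    rw [Finset.sum_const, nsmul_eq_mul, ← mul_assoc, Finset.card_univ]
    have : ((k:ℝ):ℂ) * (Fintype.card (Fin d → Fin N → Bool) : ℂ) = 1 := by exact_mod_cast hk1
    rw [this, one_mul]
  rw [h1]
  have hpi := Real.pi_pos
  set A := Real.exp (-(θ ^ 2 / (8 ^ d * Real.pi ^ 2) * T)) with hA
  calc _ ≤ ∑ x ∈ slice D m, ‖((k:ℝ):ℂ) * ∑ z : Fin d → Fin N → Bool,
      f (fun e => x (tau φ z e))‖ := norm_sum_le _ _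
    _ ≤ ∑ x ∈ slice D m, ((if (good φ x : ℝ) < T then 1 else 0) + A) := by
      refine Finset.sum_le_sum (fun x _ => ?_)
      have h2 := core hd φ 𝒞 (fun i => by convert hc1 i) (fun E hE h => by convert hc2 E hE h) hθ x
      rw [norm_mul, Complex.norm_real, Real.norm_of_nonneg hk0]
      refine h2.trans ?_
      split_ifs with hg
      · have : Real.exp (-(θ ^ 2 / (8 ^ d * Real.pi ^ 2) *
          (Finset.univ.filter (fun i => ∀ j, x (φ ((i, j), true)) ≠ x (φ ((i, j), false)))).card)) ≤ 1 := by
          rw [Real.exp_le_one_iff, neg_nonpos]; positivity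
        have hA0 : 0 ≤ A := (Real.exp_pos _).le
        linarith
      · push Not at hg
        rw [zero_add, hA, Real.exp_le_exp, neg_le_neg_iff]
        refine mul_le_mul_of_nonneg_left ?_ (by positivity)
        refine hg.trans (le_of_eq ?_)
        unfold good
        congr!
    _ = (((slice D m).filter (fun x => (good φ x : ℝ) < T)).card : ℝ) + (slice D m).card * A := by
      rw [Finset.sum_add_distrib, Finset.sum_boole, Finset.sum_const, nsmul_eq_mul]
    _ ≤ _ := by
      rw [mul_add]
      gcongr
      have := bad_bound φ D hφ m hD hlam hp hp' T
      convert this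
end

section
variable {β : Type*} [Fintype β]

open Classical in
noncomputable def copies (H : SimpleGraph β) (n : ℕ) : Finset (Finset (Sym2 (Fin n))) :=
  Finset.univ.filter (fun E => ∃ f : β ↪ Fin n, (↑E : Set (Sym2 (Fin n))) = Sym2.map f '' H.edgeSet)

lemma mem_copies {H : SimpleGraph β} {n : ℕ} {E : Finset (Sym2 (Fin n))} : E ∈ copies H n ↔
    ∃ f : β ↪ Fin n, (↑E : Set (Sym2 (Fin n))) = Sym2.map f '' H.edgeSet := by
  simp [copies]

lemma copies_not_diag {H : SimpleGraph β} {n : ℕ} {E : Finset (Sym2 (Fin n))} (hE : E ∈ copies H n)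
    {e : Sym2 (Fin n)} (he : e ∈ E) : ¬ e.IsDiag := by
  obtain ⟨f, hf⟩ := mem_copies.1 hE
  have : e ∈ (↑E : Set (Sym2 (Fin n))) := he
  rw [hf] at this
  obtain ⟨e', he', rfl⟩ := this
  have := H.not_isDiag_of_mem_edgeSet he'
  induction e' using Sym2.ind with
  | _ a b => simpa using this

lemma mem_edgeSet_graphOfFn {n : ℕ} (x : Sym2 (Fin n) → Bool) (e : Sym2 (Fin n)) (he : ¬ e.IsDiag) :
    e ∈ (graphOfFn x).edgeSet ↔ x e = true := by
  induction e using Sym2.ind with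
  | _ a b =>
    simp only [Sym2.mk_isDiag_iff] at he
    simp [graphOfFn, he, Sym2.eq_swap (a := b) (b := a)]

lemma count_eq (H : SimpleGraph β) {n : ℕ} (x : Sym2 (Fin n) → Bool) :
    (subgraphCount H (graphOfFn x) : ℝ) = polyF (copies H n) x := by
  classical
  rw [subgraphCount, Nat.card_eq_fintype_card, Fintype.card_subtype, polyF]
  have h1 : ∀ E : Finset (Sym2 (Fin n)), ∏ e ∈ E, bval (x e) = if ∀ e ∈ E, x e = true then 1 else 0 := by
    intro E
    split_ifs with h
    · exact Finset.prod_eq_one (fun e he => by simp [bval, h e he])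
    · push Not at h
      obtain ⟨e, he, hx⟩ := h
      exact Finset.prod_eq_zero he (by simp [bval, hx])
  simp_rw [h1]
  rw [Finset.sum_boole]
  congr 2
  ext E
  simp only [Finset.mem_filter, Finset.mem_univ, true_and]
  rw [mem_copies, and_comm]
  refine and_congr_right (fun hE => ?_)
  refine forall_congr' (fun e => ?_)
  refine ⟨fun h he => ?_, fun h he => ?_⟩
  · exact (mem_edgeSet_graphOfFn x e (copies_not_diag (mem_copies.2 hE) he)).1 (h he)
  · exact (mem_edgeSet_graphOfFn x e (copies_not_diag (mem_copies.2 hE) he)).2 (h he)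

lemma const_of_connected {H : SimpleGraph β} (hconn : H.Connected) {γ : Type*} (l : β → γ)
    (h : ∀ a b, H.Adj a b → l a = l b) (a b : β) : l a = l b := by
  obtain ⟨w⟩ := hconn.preconnected a b
  induction w with
  | nil => rfl
  | cons hadj _ ih => exact (h _ _ hadj).trans ih

noncomputable def vlab {N n d : ℕ} (ψ : Fin N × (β ⊕ (Fin d × Bool)) ↪ Fin n) :
    Fin n → Option (Fin N × Option (Fin d)) :=
  Function.extend ψ (fun k => some (k.1, k.2.elim (fun _ => none) (fun q => some q.1))) (fun _ => none)

lemma vlab_apply {N n d : ℕ} (ψ : Fin N × (β ⊕ (Fin d × Bool)) ↪ Fin n) (k) :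
    vlab ψ (ψ k) = some (k.1, k.2.elim (fun _ => none) (fun q => some q.1)) :=
  ψ.injective.extend_apply _ _ _

def phi0 {N n d : ℕ} (H : SimpleGraph β) (ed : Fin d ≃ H.edgeSet)
    (ψ : Fin N × (β ⊕ (Fin d × Bool)) ↪ Fin n) (k : (Fin N × Fin d) × Bool) : Sym2 (Fin n) :=
  if k.2 then s(ψ (k.1.1, Sum.inr (k.1.2, false)), ψ (k.1.1, Sum.inr (k.1.2, true)))
  else Sym2.map (fun v => ψ (k.1.1, Sum.inl v)) (ed k.1.2 : Sym2 β)

lemma phi0_lab {N n d : ℕ} (H : SimpleGraph β) (ed : Fin d ≃ H.edgeSet)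
    (ψ : Fin N × (β ⊕ (Fin d × Bool)) ↪ Fin n) (k : (Fin N × Fin d) × Bool) (v : Fin n)
    (hv : v ∈ phi0 H ed ψ k) : vlab ψ v = some (k.1.1, if k.2 then some k.1.2 else none) := by
  obtain ⟨⟨i, j⟩, b⟩ := k
  cases b
  · simp only [phi0, Bool.false_eq_true, if_false, Sym2.mem_map] at hv
    obtain ⟨a, -, rfl⟩ := hv
    rw [vlab_apply]; rfl
  · simp only [phi0, if_true, Sym2.mem_iff] at hv
    rcases hv with rfl | rfl <;> rw [vlab_apply] <;> rfl

lemma phi0_inj {N n d : ℕ} (H : SimpleGraph β) (ed : Fin d ≃ H.edgeSet)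
    (ψ : Fin N × (β ⊕ (Fin d × Bool)) ↪ Fin n) : Function.Injective (phi0 H ed ψ) := by
  intro k k' h
  have h1 := phi0_lab H ed ψ k _ (Sym2.out_fst_mem _)
  have h2 := phi0_lab H ed ψ k' (phi0 H ed ψ k).out.1 (by rw [← h]; exact Sym2.out_fst_mem _)
  rw [h1] at h2
  obtain ⟨⟨i, j⟩, b⟩ := k
  obtain ⟨⟨i', j'⟩, b'⟩ := k'
  simp only [Option.some.injEq, Prod.mk.injEq] at h2
  obtain ⟨rfl, h3⟩ := h2
  cases b <;> cases b' <;> simp at h3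
  · simp only [phi0, Bool.false_eq_true, if_false] at h
    have hi : Function.Injective (fun v : β => ψ (i, Sum.inl v)) := by
      intro a b hab
      simpa using hab
    have h4 := Sym2.map.injective hi h
    have h5 := ed.injective (Subtype.ext h4)
    rw [h5]
  · rw [h3]

lemma phi0_not_diag {N n d : ℕ} (H : SimpleGraph β) (ed : Fin d ≃ H.edgeSet)
    (ψ : Fin N × (β ⊕ (Fin d × Bool)) ↪ Fin n) (k : (Fin N × Fin d) × Bool) :
    ¬ (phi0 H ed ψ k).IsDiag := by
  obtain ⟨⟨i, j⟩, b⟩ := k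
  cases b
  · simp only [phi0, Bool.false_eq_true, if_false]
    have := H.not_isDiag_of_mem_edgeSet (ed j).2
    generalize ((ed j : H.edgeSet) : Sym2 β) = e at this
    induction e using Sym2.ind with
    | _ a b => simpa using this
  · simp [phi0]

open Classical in
lemma hc1_graph {N n d : ℕ} (H : SimpleGraph β) (ed : Fin d ≃ H.edgeSet)
    (ψ : Fin N × (β ⊕ (Fin d × Bool)) ↪ Fin n) (i : Fin N) :
    Finset.univ.image (fun j => phi0 H ed ψ ((i, j), false)) ∈ copies H n := by
  rw [mem_copies]
  refine ⟨⟨fun v => ψ (i, Sum.inl v), fun a b hab => by simpa using hab⟩, ?_⟩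
  ext e
  simp only [Finset.coe_image, Finset.coe_univ, Set.image_univ, Set.mem_range, Set.mem_image]
  constructor
  · rintro ⟨j, rfl⟩; exact ⟨ed j, (ed j).2, rfl⟩
  · rintro ⟨e', he', rfl⟩; exact ⟨ed.symm ⟨e', he'⟩, by simp [phi0]; rfl⟩

open Classical in
lemma hc2_graph {N n d : ℕ} (hd : 2 ≤ d) (H : SimpleGraph β) (hconn : H.Connected)
    (ed : Fin d ≃ H.edgeSet)
    (ψ : Fin N × (β ⊕ (Fin d × Bool)) ↪ Fin n) (E : Finset (Sym2 (Fin n))) (hE : E ∈ copies H n)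
    (h : ∀ j, ∃ i b, phi0 H ed ψ ((i, j), b) ∈ E) :
    ∃ i, E = Finset.univ.image (fun j => phi0 H ed ψ ((i, j), false)) := by
  obtain ⟨f, hf⟩ := mem_copies.1 hE
  choose I B hIB using h
  have hcard : E.card ≤ d := by
    have : E = Finset.univ.image (fun j => Sym2.map f (ed j : Sym2 β)) := by
      apply Finset.coe_injective
      rw [hf]
      ext e
      simp only [Finset.coe_image, Finset.coe_univ, Set.image_univ, Set.mem_range, Set.mem_image]
      constructor
      · rintro ⟨e', he', rfl⟩; exact ⟨ed.symm ⟨e', he'⟩, by simp⟩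
      · rintro ⟨j, rfl⟩; exact ⟨ed j, (ed j).2, rfl⟩
    rw [this]
    exact Finset.card_image_le.trans (by simp)
  have hEim : Finset.univ.image (fun j => phi0 H ed ψ ((I j, j), B j)) = E := by
    apply Finset.eq_of_subset_of_card_le
    · intro e he
      obtain ⟨j, -, rfl⟩ := Finset.mem_image.1 he
      exact hIB j
    · rw [Finset.card_image_of_injective]
      · simpa using hcard
      · intro j j' hjj
        have := phi0_inj H ed ψ hjj
        simp only [Prod.mk.injEq] at this
        exact this.1.2
  have hadj : ∀ a b, H.Adj a b → vlab ψ (f a) = vlab ψ (f b) := by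
    intro a b hab
    have h1 : s(f a, f b) ∈ E := by
      have : s(f a, f b) ∈ (↑E : Set (Sym2 (Fin n))) := by
        rw [hf]; exact ⟨s(a, b), hab, rfl⟩
      exact this
    rw [← hEim] at h1
    obtain ⟨j, -, hj⟩ := Finset.mem_image.1 h1
    rw [phi0_lab H ed ψ _ (f a) (hj ▸ Sym2.mem_mk_left _ _),
      phi0_lab H ed ψ _ (f b) (hj ▸ Sym2.mem_mk_right _ _)]
  have hcst := const_of_connected hconn _ hadj
  have hL : ∀ j j', (I j, if B j then some j else none) = (I j', if B j' then some j' else none) := by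
    have : ∀ j, ∃ a, vlab ψ (f a) = some (I j, if B j then some j else none) := by
      intro j
      have h1 : phi0 H ed ψ ((I j, j), B j) ∈ (↑E : Set (Sym2 (Fin n))) := hIB j
      rw [hf] at h1
      obtain ⟨e', -, he'⟩ := h1
      refine ⟨e'.out.1, phi0_lab H ed ψ ((I j, j), B j) _ ?_⟩
      rw [← he', Sym2.mem_map]
      exact ⟨_, Sym2.out_fst_mem _, rfl⟩
    intro j j'
    obtain ⟨a, ha⟩ := this j
    obtain ⟨a', ha'⟩ := this j'
    rw [hcst a a', ha'] at ha
    exact (Option.some.inj ha).symm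
  have hB : ∀ j, B j = false := by
    intro j
    by_contra hj
    have hj' : B j = true := by simpa using hj
    obtain ⟨j', hne⟩ : ∃ j' : Fin d, j' ≠ j := by
      have : Nontrivial (Fin d) := Fin.nontrivial_iff_two_le.2 hd
      exact exists_ne j
    have := (Prod.mk.inj (hL j j')).2
    rw [hj'] at this
    simp only [if_true] at this
    split_ifs at this
    exact hne (Option.some.inj this).symm
  refine ⟨I ⟨0, by omega⟩, ?_⟩
  rw [← hEim]
  congr 1
  ext j : 1
  rw [hB j, (Prod.mk.inj (hL j ⟨0, by omega⟩)).1]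
end

section
open MeasureTheory

lemma gnm_integral (n m : ℕ) (f : (Sym2 (Fin n) → Bool) → ℂ) :
    ∫ x, f x ∂(gnm n m) = (((slice (Finset.univ.filter (fun e : Sym2 (Fin n) => ¬ e.IsDiag)) m).card : ℝ)⁻¹ : ℝ) •
      ∑ x ∈ slice (Finset.univ.filter (fun e : Sym2 (Fin n) => ¬ e.IsDiag)) m, f x := by
  classical
  set S := {x : Sym2 (Fin n) → Bool | (∀ e : Sym2 (Fin n), e.IsDiag → x e = false) ∧
    (Finset.univ.filter fun e : Sym2 (Fin n) => x e = true).card = m} with hS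
  have hmem : ∀ x, x ∈ S ↔ x ∈ slice (Finset.univ.filter (fun e : Sym2 (Fin n) => ¬ e.IsDiag)) m := by
    intro x
    simp [hS, slice]
  have hcard : Nat.card S = (slice (Finset.univ.filter (fun e : Sym2 (Fin n) => ¬ e.IsDiag)) m).card := by
    rw [Nat.card_congr (Equiv.subtypeEquivRight hmem)]
    simp
  rw [gnm, finUniform, integral_smul_measure, integral_finsetSum_measure]
  · rw [← hS, hcard, ENNReal.toReal_inv, ENNReal.toReal_natCast]
    congr 1
    rw [← Finset.sum_subset (Finset.subset_univ (slice (Finset.univ.filter (fun e : Sym2 (Fin n) => ¬ e.IsDiag)) m))]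
    · refine Finset.sum_congr rfl (fun x hx => ?_)
      rw [integral_smul_measure, integral_dirac, Set.indicator_of_mem ((hmem x).2 hx)]
      simp
    · intro x _ hx
      rw [Set.indicator_of_notMem (fun h => hx ((hmem x).1 h))]
      simp
  · intro x _
    refine Integrable.smul_measure (integrable_dirac (by simp)) ?_
    rw [← hS]
    by_cases h : x ∈ S
    · rw [Set.indicator_of_mem h]; simp
    · rw [Set.indicator_of_notMem h]; simp

noncomputable def gw {n : ℕ} (p : ℝ) (x : Sym2 (Fin n) → Bool) : ℝ :=
  (∏ e, ENNReal.ofReal (if x e then p else 1 - p)).toReal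

lemma gnp_integral (n : ℕ) (p : ℝ) (f : (Sym2 (Fin n) → Bool) → ℝ) :
    ∫ x, f x ∂(gnp n p) = ∑ x, gw p x * f x := by
  rw [gnp, bernoulliPi, integral_finsetSum_measure]
  · refine Finset.sum_congr rfl (fun x _ => ?_)
    rw [integral_smul_measure, integral_dirac]
    rfl
  · intro x _
    refine Integrable.smul_measure (integrable_dirac (by simp)) ?_
    exact (ENNReal.prod_lt_top (fun e _ => ENNReal.ofReal_lt_top)).ne

def sperm {n : ℕ} (π : Equiv.Perm (Fin n)) : Equiv.Perm (Sym2 (Fin n)) where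
  toFun := Sym2.map π
  invFun := Sym2.map π.symm
  left_inv e := by rw [Sym2.map_map]; simp
  right_inv e := by rw [Sym2.map_map]; simp

variable {β : Type*} [Fintype β]

lemma copies_map (H : SimpleGraph β) {n : ℕ} (π : Equiv.Perm (Fin n)) (E : Finset (Sym2 (Fin n)))
    (hE : E ∈ copies H n) : E.map (sperm π).toEmbedding ∈ copies H n := by
  obtain ⟨f, hf⟩ := mem_copies.1 hE
  refine mem_copies.2 ⟨f.trans π.toEmbedding, ?_⟩
  rw [Finset.coe_map, hf, Set.image_image]
  refine Set.image_congr' (fun e => ?_)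
  change Sym2.map π (Sym2.map f e) = _
  rw [Sym2.map_map]
  rfl

lemma polyF_perm (H : SimpleGraph β) {n : ℕ} (π : Equiv.Perm (Fin n)) (y : Sym2 (Fin n) → Bool) :
    polyF (copies H n) (fun e => y (sperm π e)) = polyF (copies H n) y := by
  unfold polyF
  have hinv : ∀ (ρ τ : Equiv.Perm (Fin n)) (_ : ∀ e, sperm ρ (sperm τ e) = e) (E : Finset (Sym2 (Fin n))),
      (E.map (sperm τ).toEmbedding).map (sperm ρ).toEmbedding = E := by
    intro ρ τ h E
    rw [Finset.map_map]
    ext e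
    simp [h]
  refine Finset.sum_nbij' (fun E => E.map (sperm π).toEmbedding)
    (fun E => E.map (sperm π.symm).toEmbedding) (fun E hE => copies_map H π E hE)
    (fun E hE => copies_map H _ E hE) (fun E _ => hinv _ _ (sperm π).left_inv E)
    (fun E _ => hinv _ _ (sperm π).right_inv E) (fun E _ => ?_)
  rw [Finset.prod_map]
  rfl

lemma coef_perm (H : SimpleGraph β) {n : ℕ} (p : ℝ) (π : Equiv.Perm (Fin n)) (e : Sym2 (Fin n)) :
    ∫ y, polyF (copies H n) y * chiMono p {sperm π e} y ∂(gnp n p) =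
    ∫ y, polyF (copies H n) y * chiMono p {e} y ∂(gnp n p) := by
  rw [gnp_integral, gnp_integral]
  refine Fintype.sum_equiv ((sperm π).symm.arrowCongr (Equiv.refl Bool)) _ _ (fun y => ?_)
  have h0 : ((sperm π).symm.arrowCongr (Equiv.refl Bool)) y = fun e => y (sperm π e) := rfl
  rw [h0, polyF_perm]
  congr 1
  · unfold gw
    congr 1
    exact (Equiv.prod_comp (sperm π) (fun e => ENNReal.ofReal (if y e then p else 1 - p))).symm

lemma exists_perm {n : ℕ} (e e' : Sym2 (Fin n)) (he : ¬ e.IsDiag) (he' : ¬ e'.IsDiag) :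
    ∃ π, sperm π e = e' := by
  induction e using Sym2.ind with
  | _ a b =>
  induction e' using Sym2.ind with
  | _ c d =>
    simp only [Sym2.mk_isDiag_iff] at he he'
    refine ⟨(Equiv.swap a c).trans (Equiv.swap (Equiv.swap a c b) d), ?_⟩
    have h1 : Equiv.swap a c b ≠ c := by
      intro h
      have : Equiv.swap a c b = Equiv.swap a c a := by rw [h]; simp
      exact he ((Equiv.swap a c).injective this).symm
    change s(_, _) = _
    simp only [Equiv.trans_apply, Equiv.swap_apply_left]
    rw [Equiv.swap_apply_of_ne_of_ne h1.symm he']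

open Classical in
lemma cond2 {n : ℕ} (E : Finset (Sym2 (Fin n))) :
    ((∀ e ∈ E, ¬ e.IsDiag) ∧
        (Finset.univ.filter fun v : Fin n => ∃ e ∈ E, v ∈ e).card = 2) ↔
    ∃ e : Sym2 (Fin n), ¬ e.IsDiag ∧ {e} = E := by
  constructor
  · rintro ⟨h1, h2⟩
    have hne : E.Nonempty := by
      rw [Finset.nonempty_iff_ne_empty]
      rintro rfl
      simp at h2
    obtain ⟨e, he⟩ := hne
    refine ⟨e, h1 e he, ?_⟩
    have hed := h1 e he
    induction e using Sym2.ind with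
    | _ a b =>
    simp only [Sym2.mk_isDiag_iff] at hed
    have hV : {a, b} = (Finset.univ.filter fun v : Fin n => ∃ e ∈ E, v ∈ e) := by
      apply Finset.eq_of_subset_of_card_le
      · intro v hv
        simp only [Finset.mem_insert, Finset.mem_singleton] at hv
        simp only [Finset.mem_filter, Finset.mem_univ, true_and]
        exact ⟨_, he, by simpa using hv⟩
      · rw [h2, Finset.card_pair hed]
    symm
    rw [Finset.eq_singleton_iff_unique_mem]
    refine ⟨he, fun e' he' => ?_⟩
    have hed' := h1 e' he'
    induction e' using Sym2.ind with
    | _ c d =>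
    simp only [Sym2.mk_isDiag_iff] at hed'
    have hc : c ∈ ({a, b} : Finset (Fin n)) := by
      rw [hV]; simp only [Finset.mem_filter, Finset.mem_univ, true_and]
      exact ⟨_, he', by simp⟩
    have hd : d ∈ ({a, b} : Finset (Fin n)) := by
      rw [hV]; simp only [Finset.mem_filter, Finset.mem_univ, true_and]
      exact ⟨_, he', by simp⟩
    simp only [Finset.mem_insert, Finset.mem_singleton] at hc hd
    rw [Sym2.eq_iff]
    grind
  · rintro ⟨e, he, rfl⟩
    refine ⟨by simpa using he, ?_⟩
    induction e using Sym2.ind with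
    | _ a b =>
    simp only [Sym2.mk_isDiag_iff] at he
    rw [← Finset.card_pair he]
    congr 1
    ext v
    simp

lemma order0_const {n : ℕ} (p : ℝ) (F : (Sym2 (Fin n) → Bool) → ℝ) (x x' : Sym2 (Fin n) → Bool) :
    orderPart p 0 F x = orderPart p 0 F x' := by
  classical
  unfold orderPart
  refine Finset.sum_congr rfl (fun E _ => ?_)
  split_ifs with h
  · have : E = ∅ := by
      rw [Finset.eq_empty_iff_forall_notMem]
      intro e he
      have h2 := Finset.card_eq_zero.1 h.2
      have : e.out.1 ∈ (∅ : Finset (Fin n)) := by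
        rw [← h2]
        simp only [Finset.mem_filter, Finset.mem_univ, true_and]
        exact ⟨e, he, Sym2.out_fst_mem _⟩
      simp at this
    simp [this, chiMono]
  · rfl

lemma order2_const (H : SimpleGraph β) {n m : ℕ} (p : ℝ) :
    ∃ k : ℝ, ∀ x ∈ slice (Finset.univ.filter (fun e : Sym2 (Fin n) => ¬ e.IsDiag)) m,
      orderPart p 2 (polyF (copies H n)) x = k := by
  classical
  set D := Finset.univ.filter (fun e : Sym2 (Fin n) => ¬ e.IsDiag) with hD
  obtain ⟨a, ha⟩ : ∃ a : ℝ, ∀ e ∈ D,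
      ∫ y, polyF (copies H n) y * chiMono p {e} y ∂(gnp n p) = a := by
    by_cases hne : D.Nonempty
    · obtain ⟨e0, he0⟩ := hne
      refine ⟨∫ y, polyF (copies H n) y * chiMono p {e0} y ∂(gnp n p), fun e he => ?_⟩
      simp only [hD, Finset.mem_filter, Finset.mem_univ, true_and] at he he0
      obtain ⟨π, rfl⟩ := exists_perm e0 e he0 he
      exact coef_perm H p π e0
    · rw [Finset.not_nonempty_iff_eq_empty] at hne
      exact ⟨0, by simp [hne]⟩
  have h1 : ∀ x, orderPart p 2 (polyF (copies H n)) x = ∑ e ∈ D, a * chiMono p {e} x := by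
    intro x
    unfold orderPart
    rw [← Finset.sum_filter]
    have : (Finset.univ.filter (fun E : Finset (Sym2 (Fin n)) => (∀ e ∈ E, ¬ e.IsDiag) ∧
        (Finset.univ.filter fun v : Fin n => ∃ e ∈ E, v ∈ e).card = 2)) =
        D.image (fun e => {e}) := by
      ext E
      rw [Finset.mem_filter, cond2]
      simp [hD]
    rw [this, Finset.sum_image (fun a _ b _ h => Finset.singleton_injective h)]
    exact Finset.sum_congr rfl (fun e he => by rw [ha e he])
  refine ⟨a * ((m - D.card * p) / Real.sqrt (p * (1 - p))), fun x hx => ?_⟩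
  rw [h1, ← Finset.mul_sum]
  congr 1
  simp only [chiMono, Finset.prod_singleton]
  rw [← Finset.sum_div, Finset.sum_sub_distrib, Finset.sum_boole, Finset.sum_const, nsmul_eq_mul]
  congr 3
  simp only [slice, Finset.mem_filter, Finset.mem_univ, true_and] at hx
  rw [← hx.2]
  congr 1
  ext e
  simp only [Finset.mem_filter, Finset.mem_univ, true_and, and_iff_right_iff_imp]
  intro he
  by_contra hcon
  rw [hx.1 e hcon] at he
  cases he
end

set_option maxHeartbeats 4000000 in
lemma final_bound {β : Type*} [Fintype β] (H : SimpleGraph β) (hconn : H.Connected)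
    (hcard : 3 ≤ Fintype.card β)
    (lam : ℝ) (hlam : lam ∈ Set.Ioo (0 : ℝ) (1 / 2)) :
    ∃ c C : ℝ, 0 < c ∧ 0 < C ∧ ∀ n : ℕ, Fintype.card β ≤ n → ∀ m : ℕ,
      (m : ℝ) / (n.choose 2) ∈ Set.Ioo lam (1 - lam) → ∀ θ : ℝ, |θ| ≤ Real.pi →
      ‖∑ x ∈ slice (Finset.univ.filter (fun e : Sym2 (Fin n) => ¬ e.IsDiag)) m,
        Complex.exp (Complex.I * ((θ * polyF (copies H n) x : ℝ) : ℂ))‖ ≤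
      (slice (Finset.univ.filter (fun e : Sym2 (Fin n) => ¬ e.IsDiag)) m).card *
      (C * (Real.exp (-(c * n)) + Real.exp (-(c * θ ^ 2 * n)))) := by
  classical
  set d := Fintype.card H.edgeSet with hd
  have hd2 : 2 ≤ d := by
    have := hconn.card_vert_le_card_edgeSet_add_one
    simp only [Nat.card_eq_fintype_card] at this
    omega
  let ed : Fin d ≃ H.edgeSet := (Fintype.equivFin _).symm
  set L := Fintype.card (β ⊕ (Fin d × Bool)) with hL
  have hLpos : 0 < L := by
    rw [hL, Fintype.card_sum]; omega
  have hLr : (0:ℝ) < L := by exact_mod_cast hLpos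
  obtain ⟨hl0, hl1⟩ := hlam
  have hpw0 : 0 < lam ^ (2 * d) := by positivity
  have hpw1 : lam ^ (2 * d) ≤ 1 := pow_le_one₀ hl0.le (by linarith)
  set κ := 1 - lam ^ (2 * d) / 2 with hκ
  have hκ0 : 0 < κ := by rw [hκ]; linarith
  have hκ1 : κ < 1 := by rw [hκ]; linarith
  set a := -Real.log κ with ha
  have ha0 : 0 < a := by rw [ha]; linarith [Real.log_neg hκ0 hκ1]
  have hlog2 := Real.log_pos (x := 2) (by norm_num)
  have hpi := Real.pi_pos
  set b := a / 2 with hb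
  have hb0 : 0 < b := by positivity
  set g := a / (2 * Real.log 2) / (8 ^ d * Real.pi ^ 2) with hg
  have hg0 : 0 < g := by positivity
  set s := b / L with hs
  have hs0 : 0 < s := by positivity
  set C1 := (1 + 8 / s ^ 2) * Real.exp b with hC1
  set C2 := Real.exp (g * Real.pi ^ 2) with hC2
  have hC1' : 0 < C1 := by positivity
  have hC2' : 0 < C2 := by positivity
  set c := min (s / 2) (g / L) with hc
  have hc1 : c ≤ s / 2 := min_le_left _ _
  have hc2 : c ≤ g / L := min_le_right _ _
  refine ⟨c, C1 + C2, lt_min (by positivity) (by positivity), by positivity, ?_⟩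
  intro n hn m hm θ hθ
  set D := Finset.univ.filter (fun e : Sym2 (Fin n) => ¬ e.IsDiag) with hD
  have hDcard : D.card = n.choose 2 := by
    rw [hD, ← Fintype.card_subtype, Sym2.card_subtype_not_diag, Fintype.card_fin]
  have hDpos : 0 < D.card := by
    rw [hDcard]; exact Nat.choose_pos (by omega)
  rw [← hDcard] at hm
  set N := n / L with hN
  have hNn : (n:ℝ) / L - 1 ≤ N := by
    have h1 : n < L * (N + 1) := Nat.lt_mul_div_succ n hLpos
    have h2 : (n:ℝ) < L * (N + 1) := by exact_mod_cast h1
    rw [sub_le_iff_le_add, div_le_iff₀ hLr]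
    linarith
  obtain ⟨ψ⟩ : Nonempty (Fin N × (β ⊕ (Fin d × Bool)) ↪ Fin n) := by
    apply Function.Embedding.nonempty_of_card_le
    rw [Fintype.card_prod, Fintype.card_fin, Fintype.card_fin, ← hL]
    exact Nat.div_mul_le_self n L
  let φ : (Fin N × Fin d) × Bool ↪ Sym2 (Fin n) := ⟨phi0 H ed ψ, phi0_inj H ed ψ⟩
  set T := a * N / (2 * Real.log 2) with hT
  have hmain := slice_bound (by omega : d ≠ 0) φ D
    (fun k => by rw [hD, Finset.mem_filter]; exact ⟨Finset.mem_univ _, phi0_not_diag H ed ψ k⟩)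
    (copies H n) (fun i => by convert hc1_graph H ed ψ i; rfl)
    (fun E hE h => by
      obtain ⟨i, hi⟩ := hc2_graph hd2 H hconn ed ψ E hE h
      refine ⟨i, hi.trans ?_⟩
      congr!) m hDpos hl0 hm.1.le hm.2.le hθ T
  refine hmain.trans ?_
  refine mul_le_mul_of_nonneg_left ?_ (by positivity)
  have hn0 : (0:ℝ) ≤ n := by positivity
  -- first term
  have t1 : ((D.card : ℝ) + 1) * (Real.exp (T * Real.log 2) * κ ^ N) ≤ C1 * Real.exp (-(c * n)) := by
    have e1 : Real.exp (T * Real.log 2) * κ ^ N = Real.exp (-(b * N)) := by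
      have : κ ^ N = Real.exp (-(a * N)) := by
        rw [ha, neg_mul, neg_neg, mul_comm, Real.exp_nat_mul, Real.exp_log hκ0]
      rw [this, ← Real.exp_add]
      congr 1
      rw [hT, hb]; field_simp; ring
    have e2 : Real.exp (-(b * N)) ≤ Real.exp b * Real.exp (-(s * n)) := by
      rw [← Real.exp_add, Real.exp_le_exp]
      have : s * n = b * (n / L) := by rw [hs]; ring
      rw [this]
      have h := mul_le_mul_of_nonneg_left hNn hb0.le
      rw [mul_sub, mul_one] at h
      linarith
    have e3 : (D.card : ℝ) + 1 ≤ (1 + 8 / s ^ 2) * Real.exp (s / 2 * n) := by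
      have f1 : (D.card : ℝ) ≤ (n:ℝ) ^ 2 := by
        rw [hDcard]; exact_mod_cast Nat.choose_le_pow n 2
      have hu : 0 ≤ s / 2 * n := by positivity
      have f2 := Real.quadratic_le_exp_of_nonneg hu
      have f3 : (n:ℝ) ^ 2 ≤ 8 / s ^ 2 * Real.exp (s / 2 * n) := by
        rw [div_mul_eq_mul_div, le_div_iff₀ (by positivity)]
        have h : (s / 2 * (n:ℝ)) ^ 2 = (n:ℝ) ^ 2 * s ^ 2 / 4 := by ring
        linarith
      have f4 := Real.one_le_exp hu
      linarith
    rw [e1]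
    calc _ ≤ ((1 + 8 / s ^ 2) * Real.exp (s / 2 * n)) * (Real.exp b * Real.exp (-(s * n))) := by gcongr
      _ = C1 * Real.exp (-(s / 2 * n)) := by
        have : Real.exp (-(s / 2 * n)) = Real.exp (s / 2 * n) * Real.exp (-(s * n)) := by
          rw [← Real.exp_add]; congr 1; ring
        rw [this, hC1]; ring
      _ ≤ _ := by gcongr
  have t2 : Real.exp (-(θ ^ 2 / (8 ^ d * Real.pi ^ 2) * T)) ≤ C2 * Real.exp (-(c * θ ^ 2 * n)) := by
    rw [hC2, ← Real.exp_add, Real.exp_le_exp]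
    have e1 : θ ^ 2 / (8 ^ d * Real.pi ^ 2) * T = g * θ ^ 2 * N := by
      rw [hT, hg]; field_simp
    rw [e1]
    have e2 : θ ^ 2 ≤ Real.pi ^ 2 := sq_le_sq' (by linarith [(abs_le.1 hθ).1]) (abs_le.1 hθ).2
    have e3 : g * θ ^ 2 * (n / L - 1) ≤ g * θ ^ 2 * N := by gcongr
    have e4 : c * θ ^ 2 * n ≤ g / L * θ ^ 2 * n := by gcongr
    have e5 : g / L * θ ^ 2 * n = g * θ ^ 2 * (n / L) := by ring
    have e6 := mul_le_mul_of_nonneg_left e2 hg0.le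
    rw [mul_sub, mul_one] at e3
    linarith
  have p1 := Real.exp_pos (-(c * n))
  have p2 := Real.exp_pos (-(c * θ ^ 2 * n))
  have q1 := mul_pos hC1' p2
  have q2 := mul_pos hC2' p1
  refine (add_le_add t1 t2).trans ?_
  rw [add_mul, mul_add, mul_add]
  linarith

theorem subgraph_count_char_fun_top_range
    {β : Type*} [Fintype β] (H : SimpleGraph β) (hconn : H.Connected)
    (hcard : 3 ≤ Fintype.card β)
    (lam : ℝ) (hlam : lam ∈ Set.Ioo (0 : ℝ) (1 / 2)) :
    ∃ c C : ℝ, 0 < c ∧ 0 < C ∧ ∀ n : ℕ, Fintype.card β ≤ n → ∀ m : ℕ,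
      (m : ℝ) / (n.choose 2) ∈ Set.Ioo lam (1 - lam) →
      let p : ℝ := (m : ℝ) / (n.choose 2)
      let F : (Sym2 (Fin n) → Bool) → ℝ := fun x => (subgraphCount H (graphOfFn x) : ℝ)
      let σ := Real.sqrt (∫ x, (orderPart p 3 F x -
        ∫ y, orderPart p 3 F y ∂(gnp n p)) ^ 2 ∂(gnp n p))
      let K : (Sym2 (Fin n) → Bool) → ℝ := fun x =>
        (F x - orderPart p 0 F x - orderPart p 2 F x) / σ
      ∀ t : ℝ, |t| ≤ Real.pi * σ →
        ‖∫ x, Complex.exp (Complex.I * Complex.ofReal (t * K x)) ∂(gnm n m)‖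
          ≤ C * (Real.exp (-(c * n)) + Real.exp (-(c * t ^ 2 * n / σ ^ 2))) := by
  obtain ⟨c, C, hc, hC, hmain⟩ := final_bound H hconn hcard lam hlam
  refine ⟨c, C, hc, hC, ?_⟩
  intro n hn m hm p F σ K t ht
  have hF : F = polyF (copies H n) := funext (fun x => count_eq H x)
  have hσ : 0 ≤ σ := Real.sqrt_nonneg _
  clear_value σ
  set θ := t / σ with hθdef
  have hθ : |θ| ≤ Real.pi := by
    rw [hθdef, abs_div, abs_of_nonneg hσ]
    exact div_le_of_le_mul₀ hσ Real.pi_pos.le ht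
  have hb := hmain n hn m hm θ hθ
  have e1 : c * t ^ 2 * n / σ ^ 2 = c * θ ^ 2 * n := by rw [hθdef, div_pow]; ring
  rw [e1, gnm_integral]
  set S := slice (Finset.univ.filter (fun e : Sym2 (Fin n) => ¬ e.IsDiag)) m with hS
  obtain ⟨k2, hk2⟩ := order2_const H (n := n) (m := m) p
  have e2 : ∑ x ∈ S, Complex.exp (Complex.I * Complex.ofReal (t * K x)) =
      Complex.exp (((-(θ * (orderPart p 0 F (fun _ => false) + k2)) : ℝ) : ℂ) * Complex.I) *
      ∑ x ∈ S, Complex.exp (Complex.I * ((θ * polyF (copies H n) x : ℝ) : ℂ)) := by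
    rw [Finset.mul_sum]
    refine Finset.sum_congr rfl (fun x hx => ?_)
    rw [← Complex.exp_add]
    congr 1
    have : t * K x = -(θ * (orderPart p 0 F (fun _ => false) + k2)) + θ * polyF (copies H n) x := by
      simp only [K]
      rw [order0_const p F x (fun _ => false), hF, hk2 x hx, hθdef]
      ring
    rw [this, Complex.ofReal_add]
    ring
  rw [e2, norm_smul, norm_mul, Complex.norm_exp_ofReal_mul_I, one_mul, norm_inv, Real.norm_natCast]
  have hR : 0 ≤ C * (Real.exp (-(c * n)) + Real.exp (-(c * θ ^ 2 * n))) := by positivity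
  rcases Nat.eq_zero_or_pos S.card with h0 | h0
  · rw [h0]; simpa using hR
  · rw [inv_mul_le_iff₀ (by exact_mod_cast h0)]
    exact hb
end

section
/- Let H be a graph on ℓ ≥ 3 vertices and λ ∈ (0,1/2). There exist a finite set P ⊆ (0,1) with |P| ≤ v(H)² (depending only on H) and constants c, C > 0 depending only on H and λ, such that the following holds for all n ≥ v(H) and all integers m for which p = m/C(n,2) lies in (λ,1−λ) and satisfies |p − q| ≥ λ for all q ∈ P. Sample G ~ G(n,m) with edge indicators x_e and χ_e = (x_e − p)/√(p(1−p)); expand the induced subgraph count X_H of H in G as a polynomial in the χ_e, let W_j denote its degree-j part (W_0 and W_2 are deterministic given m), let σ be the standard deviation of W_3 when the χ_e are instead independent normalized Bernoulli(p) variables, and set 𝒦 = (X_H − W_0 − W_2)/σ. Then for all t ∈ ℝ with |t| ≤ π·σ: |E[exp(it·𝒦)]| ≤ C·(exp(−c·n) + exp(−c·t²·n/σ²)). -/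
open MeasureTheory ProbabilityTheory
open scoped ENNReal NNReal

noncomputable section

/-- The number of induced copies of `H` in `G`. -/
def inducedCount {β : Type*} [Fintype β] (H : SimpleGraph β) {n : ℕ}
    (G : SimpleGraph (Fin n)) : ℕ :=
  Nat.card {U : Finset (Fin n) // U.card = Fintype.card β ∧
    Nonempty (H ≃g (G.induce (↑U : Set (Fin n))))}

end
set_option linter.all false
namespace ICF

/-- mixed difference -/
def DD {A : Type} : (k : ℕ) → ((Fin k → A) → ℝ) → (Fin k → A × A) → ℝ
  | 0, φ, _ => φ (fun j => j.elim0)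
  | k + 1, φ, δ => DD k (fun r => φ (Fin.cons (δ 0).1 r) - φ (Fin.cons (δ 0).2 r)) (Fin.tail δ)

noncomputable def ex (t : ℝ) : ℂ := Complex.exp (t * Complex.I)

lemma norm_ex (t : ℝ) : ‖ex t‖ = 1 := by
  unfold ex; exact Complex.norm_exp_ofReal_mul_I t

lemma ex_add (s t : ℝ) : ex (s + t) = ex s * ex t := by
  unfold ex; rw [← Complex.exp_add]; congr 1; push_cast; ring

lemma ex_sub_conj (s t : ℝ) : ex (s - t) = ex s * (starRingEnd ℂ) (ex t) := by
  unfold ex; rw [← Complex.exp_conj, ← Complex.exp_add]; congr 1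
  simp; ring

lemma ex_sum {ι : Type*} (s : Finset ι) (f : ι → ℝ) : ex (∑ i ∈ s, f i) = ∏ i ∈ s, ex (f i) := by
  unfold ex; rw [← Complex.exp_sum]; congr 1; push_cast; rw [Finset.sum_mul]

/-- Cauchy-Schwarz step -/
lemma cs_step {A R : Type} [Fintype A] [Fintype R] (φ : A → R → ℝ) :
    ‖∑ a, ∑ r, ex (φ a r)‖ ^ 2 ≤
      Fintype.card R * (∑ q : A × A, ∑ r, ex (φ q.1 r - φ q.2 r)).re := by
  have h1 : ‖∑ a, ∑ r, ex (φ a r)‖ ≤ ∑ r, ‖∑ a, ex (φ a r)‖ := by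
    rw [Finset.sum_comm]; exact norm_sum_le _ _
  have h2 : (∑ r : R, ‖∑ a, ex (φ a r)‖) ^ 2 ≤ Fintype.card R * ∑ r : R, ‖∑ a, ex (φ a r)‖ ^ 2 :=
    sq_sum_le_card_mul_sum_sq
  have h3 : (∑ q : A × A, ∑ r, ex (φ q.1 r - φ q.2 r))
      = ((∑ r : R, ‖∑ a, ex (φ a r)‖ ^ 2 : ℝ) : ℂ) := by
    rw [Finset.sum_comm]; push_cast
    refine Finset.sum_congr rfl fun r _ => ?_
    rw [← Complex.mul_conj', map_sum, Finset.sum_mul_sum, Fintype.sum_prod_type]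
    simp_rw [ex_sub_conj]
  rw [h3, Complex.ofReal_re]
  exact le_trans (pow_le_pow_left₀ (norm_nonneg _) h1 2) h2

lemma jensen {Q : Type} [Fintype Q] [Nonempty Q] (T : Q → ℝ) (hT : ∀ q, 0 ≤ T q) (n : ℕ) :
    ((∑ q, T q) / Fintype.card Q) ^ n ≤ (∑ q, T q ^ n) / Fintype.card Q := by
  have hc : (Fintype.card Q : ℝ) ≠ 0 := by exact_mod_cast Fintype.card_ne_zero
  have := Real.pow_arith_mean_le_arith_mean_pow Finset.univ (fun _ : Q => (Fintype.card Q : ℝ)⁻¹) T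
    (fun _ _ => by positivity) (by simp [hc]) (fun q _ => hT q) n
  rw [← Finset.mul_sum, ← Finset.mul_sum] at this
  rw [div_eq_inv_mul, div_eq_inv_mul]; exact this

lemma sum_cons {A M : Type} [Fintype A] [AddCommMonoid M] {k : ℕ} (f : (Fin (k+1) → A) → M) :
    ∑ γ, f γ = ∑ a, ∑ r : Fin k → A, f (Fin.cons a r) := by
  rw [← Fintype.sum_prod_type']
  exact (Fintype.sum_equiv (Fin.consEquiv (fun _ => A)) _ _ (fun q => rfl)).symm

lemma decouple {A : Type} [Fintype A] [Nonempty A] : ∀ (k : ℕ) (φ : (Fin (k+1) → A) → ℝ),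
    (‖∑ γ, ex (φ γ)‖ / (Fintype.card A : ℝ) ^ (k+1)) ^ (2 ^ (k+1)) ≤
      (∑ δ, ex (DD (k+1) φ δ)).re / ((Fintype.card A : ℝ) ^ 2) ^ (k+1)
  | 0, φ => by
    have ha : (0:ℝ) < Fintype.card A := by exact_mod_cast Fintype.card_pos
    have := cs_step (A := A) (R := Fin 0 → A) (fun a r => φ (Fin.cons a r))
    rw [sum_cons, sum_cons]
    simp only [zero_add, pow_one, div_pow]
    refine div_le_div_of_nonneg_right ?_ (by positivity)
    refine this.trans (le_of_eq ?_)
    simp only [Fintype.card_unique, Nat.cast_one, one_mul]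
    congr 1
    refine Finset.sum_congr rfl fun q _ => ?_
    simp only [Finset.univ_unique, Finset.sum_singleton, DD, Fin.cons_zero]
    have : (default : Fin 0 → A) = (fun j => j.elim0) := Subsingleton.elim _ _
    rw [this]
  | k+1, φ => by
    have ha : (0:ℝ) < Fintype.card A := by exact_mod_cast Fintype.card_pos
    set a : ℝ := (Fintype.card A : ℝ) with hadef
    have h1 := cs_step (A := A) (R := Fin (k+1) → A) (fun a r => φ (Fin.cons a r))
    rw [← sum_cons (fun γ => ex (φ γ))] at h1
    set S := ‖∑ γ, ex (φ γ)‖ with hS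
    set ψ : A × A → (Fin (k+1) → A) → ℝ := fun q r => φ (Fin.cons q.1 r) - φ (Fin.cons q.2 r) with hψ
    set T : A × A → ℝ := fun q => ‖∑ r, ex (ψ q r)‖ / a ^ (k+1) with hT
    have hcR : (Fintype.card (Fin (k+1) → A) : ℝ) = a ^ (k+1) := by
      simp [hadef]
    have h2 : (S / a ^ (k+1+1)) ^ 2 ≤ (∑ q, T q) / Fintype.card (A × A) := by
      have h3 : (∑ q : A × A, ∑ r, ex (φ (Fin.cons q.1 r) - φ (Fin.cons q.2 r))).re
          ≤ ∑ q : A × A, ‖∑ r, ex (ψ q r)‖ :=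
        (Complex.re_le_norm _).trans (norm_sum_le _ _)
      have h4 : S ^ 2 ≤ a ^ (k+1) * ∑ q : A × A, ‖∑ r, ex (ψ q r)‖ := by
        rw [hcR] at h1
        exact h1.trans (mul_le_mul_of_nonneg_left h3 (by positivity))
      have h5 : (∑ q, T q) / Fintype.card (A × A) =
          (a ^ (k+1) * ∑ q : A × A, ‖∑ r, ex (ψ q r)‖) / (a ^ (k+1+1)) ^ 2 := by
        simp only [hT, Fintype.card_prod, Nat.cast_mul, ← hadef]
        rw [← Finset.sum_div]
        field_simp
        ring
      rw [h5, div_pow]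
      exact div_le_div_of_nonneg_right h4 (by positivity)
    have h6 := jensen T (fun q => by positivity) (2 ^ (k+1))
    have h7 : (∑ q, T q ^ (2 ^ (k+1))) ≤
        ∑ q, (∑ δ, ex (DD (k+1) (ψ q) δ)).re / (a ^ 2) ^ (k+1) :=
      Finset.sum_le_sum fun q _ => decouple k (ψ q)
    calc (S / a ^ (k+1+1)) ^ (2 ^ (k+1+1)) = ((S / a ^ (k+1+1)) ^ 2) ^ (2 ^ (k+1)) := by
          rw [← pow_mul]; congr 1; ring
      _ ≤ ((∑ q, T q) / Fintype.card (A × A)) ^ (2 ^ (k+1)) :=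
          pow_le_pow_left₀ (by positivity) h2 _
      _ ≤ _ := h6
      _ ≤ (∑ q, (∑ δ, ex (DD (k+1) (ψ q) δ)).re / (a ^ 2) ^ (k+1)) / Fintype.card (A × A) :=
          div_le_div_of_nonneg_right h7 (by positivity)
      _ = _ := by
          rw [← Finset.sum_div, div_div, sum_cons, ← Complex.re_sum]
          congr 1
          simp only [Fintype.card_prod, Nat.cast_mul, ← hadef]
          ring

lemma DD_sub {A : Type} : ∀ (k : ℕ) (φ ψ : (Fin k → A) → ℝ) (δ : Fin k → A × A),
    DD k (fun γ => φ γ - ψ γ) δ = DD k φ δ - DD k ψ δ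
  | 0, φ, ψ, δ => rfl
  | k+1, φ, ψ, δ => by
    simp only [DD]
    rw [← DD_sub k]
    congr 1; funext r; ring

lemma DD_sum {A : Type} {ι : Type*} (s : Finset ι) : ∀ (k : ℕ) (φ : ι → (Fin k → A) → ℝ)
    (δ : Fin k → A × A), DD k (fun γ => ∑ i ∈ s, φ i γ) δ = ∑ i ∈ s, DD k (φ i) δ
  | 0, φ, δ => rfl
  | k+1, φ, δ => by
    simp only [DD]
    rw [← DD_sum s k]
    congr 1; funext r; rw [Finset.sum_sub_distrib]

lemma DD_zero {A : Type} : ∀ (k : ℕ) (δ : Fin k → A × A), DD k (fun _ => (0:ℝ)) δ = 0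
  | 0, δ => rfl
  | k+1, δ => by simp only [DD, sub_zero]; exact DD_zero k _

lemma DD_indep {A : Type} : ∀ (k : ℕ) (φ : (Fin k → A) → ℝ) (j : Fin k)
    (_ : ∀ γ γ' : Fin k → A, (∀ i, i ≠ j → γ i = γ' i) → φ γ = φ γ') (δ : Fin k → A × A),
    DD k φ δ = 0
  | 0, φ, j, h, δ => j.elim0
  | k+1, φ, j, h, δ => by
    simp only [DD]
    induction j using Fin.cases with
    | zero =>
      convert DD_zero k (Fin.tail δ) using 2
      funext r
      rw [h _ (Fin.cons (δ 0).2 r), sub_self]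
      intro i hi
      obtain ⟨i, rfl⟩ := Fin.exists_succ_eq.2 hi
      simp
    | succ j =>
      apply DD_indep k _ j
      intro γ γ' hg
      have key : ∀ a : A, φ (Fin.cons a γ) = φ (Fin.cons a γ') := by
        intro a
        apply h
        intro i hi
        induction i using Fin.cases with
        | zero => simp
        | succ i => simp; exact hg i (fun hh => hi (by rw [hh]))
      rw [key, key]

lemma DD_prod {A : Type} : ∀ (k : ℕ) (g : Fin k → A → ℝ) (δ : Fin k → A × A),
    DD k (fun γ => ∏ j, g j (γ j)) δ = ∏ j, (g j (δ j).1 - g j (δ j).2)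
  | 0, g, δ => by simp [DD]
  | k+1, g, δ => by
    simp only [DD]
    have : (fun r : Fin k → A => ∏ j, g j ((Fin.cons (δ 0).1 r : Fin (k+1) → A) j) -
        ∏ j, g j ((Fin.cons (δ 0).2 r : Fin (k+1) → A) j)) =
        fun r => ∑ b : Unit, (g 0 (δ 0).1 - g 0 (δ 0).2) * ∏ j : Fin k, g j.succ (r j) := by
      funext r; simp [Fin.prod_univ_succ]; ring
    rw [this, DD_sum, Fin.prod_univ_succ]
    simp only [Finset.univ_unique, Finset.sum_singleton]
    have hm : ∀ (k : ℕ) (c : ℝ) (φ : (Fin k → A) → ℝ) (δ : Fin k → A × A),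
        DD k (fun r => c * φ r) δ = c * DD k φ δ := by
      intro k
      induction k with
      | zero => intro c φ δ; rfl
      | succ k ih => intro c φ δ; simp only [DD]; rw [← ih]; congr 1; funext r; ring
    rw [hm, DD_prod k]
    rfl

lemma DD_map {A B : Type} (h : A → B) : ∀ (k : ℕ) (φ : (Fin k → B) → ℝ) (δ : Fin k → A × A),
    DD k (fun γ => φ (fun j => h (γ j))) δ = DD k φ (fun j => (h (δ j).1, h (δ j).2))
  | 0, φ, δ => by simp only [DD]; congr 1; funext j; exact j.elim0
  | k+1, φ, δ => by
    simp only [DD]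
    have : ∀ (a : A) (r : Fin k → A), (fun j => h ((Fin.cons a r : Fin (k+1) → A) j)) =
        (Fin.cons (h a) (fun j => h (r j)) : Fin (k+1) → B) := by
      intro a r; funext j
      induction j using Fin.cases <;> simp
    simp_rw [this]
    exact DD_map h k (fun r => φ (Fin.cons (h (δ 0).1) r) - φ (Fin.cons (h (δ 0).2) r)) (Fin.tail δ)

def blockEquiv (k N : ℕ) : (Fin k → (Fin N → Bool) × (Fin N → Bool)) ≃
    (Fin N → Fin k → Bool × Bool) where
  toFun δ := fun i j => ((δ j).1 i, (δ j).2 i)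
  invFun η := fun j => (fun i => (η i j).1, fun i => (η i j).2)
  left_inv δ := rfl
  right_inv η := rfl

lemma block_prod (k N : ℕ) (Q : Fin N → (Fin k → Bool × Bool) → ℝ) :
    ∑ δ : Fin k → (Fin N → Bool) × (Fin N → Bool),
      ex (∑ i, Q i (fun j => ((δ j).1 i, (δ j).2 i))) = ∏ i, ∑ η, ex (Q i η) := by
  rw [Finset.prod_univ_sum, Fintype.piFinset_univ]
  refine Fintype.sum_equiv (blockEquiv k N) _ _ fun δ => ?_
  rw [ex_sum]; rfl

lemma norm_one_add_ex (s : ℝ) (hs : |s| ≤ Real.pi) :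
    ‖ex s + ex 0‖ ≤ 2 - s ^ 2 / Real.pi ^ 2 := by
  have hpi := Real.pi_pos
  have hs2 : s ^ 2 / Real.pi ^ 2 ≤ 1 := by
    rw [div_le_one (by positivity)]
    exact sq_le_sq' (by linarith [abs_le.1 hs]) (abs_le.1 hs).2
  have h1 : ‖ex s + ex 0‖ ^ 2 = 2 + 2 * Real.cos s := by
    rw [← Complex.normSq_eq_norm_sq, Complex.normSq_apply]
    simp [ex, Complex.exp_ofReal_mul_I_re, Complex.exp_ofReal_mul_I_im]
    nlinarith [Real.sin_sq_add_cos_sq s]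
  have h2 := Real.cos_le_one_sub_mul_cos_sq hs
  have h3 : 2 / Real.pi ^ 2 * s ^ 2 = 2 * (s ^ 2 / Real.pi ^ 2) := by ring
  rw [h3] at h2
  refine abs_le_of_sq_le_sq' ?_ (by linarith) |>.2
  rw [h1]
  nlinarith [sq_nonneg (s ^ 2 / Real.pi ^ 2)]

def gb (b : Bool) : ℝ := if b then 0 else 1

lemma good_block (k : ℕ) (s : ℝ) (hs : |s| ≤ Real.pi) :
    ‖∑ η : Fin (k+1) → Bool × Bool, ex (s * ∏ j, (gb (η j).1 - gb (η j).2))‖ ≤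
      (4:ℝ) ^ (k+1) * Real.exp (- (s ^ 2 / (Real.pi ^ 2 * 4 ^ (k+1)))) := by
  classical
  set f : (Fin (k+1) → Bool × Bool) → ℂ := fun η => ex (s * ∏ j, (gb (η j).1 - gb (η j).2))
  set η1 : Fin (k+1) → Bool × Bool := fun _ => (false, true)
  set η0 : Fin (k+1) → Bool × Bool := fun _ => (false, false)
  have hne : η0 ≠ η1 := fun h => by have := congrFun h 0; simp [η0, η1] at this
  have hsplit : ∑ η, f η = (f η1 + f η0) + ∑ η ∈ (Finset.univ.erase η1).erase η0, f η := by
    rw [add_assoc, Finset.add_sum_erase _ _ (by simp [hne]), Finset.add_sum_erase _ _ (by simp)]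
  have h1 : f η1 = ex s := by simp [f, η1, gb]
  have h0 : f η0 = ex 0 := by simp [f, η0, gb]
  have hcard : ((((Finset.univ : Finset (Fin (k+1) → Bool × Bool)).erase η1).erase η0).card : ℝ)
      = 4 ^ (k+1) - 2 := by
    rw [Finset.card_erase_of_mem (by simp [hne]), Finset.card_erase_of_mem (by simp)]
    have h4 : (4:ℕ) ≤ 4 ^ (k+1) := Nat.le_self_pow (by simp) 4
    have : (Finset.univ : Finset (Fin (k+1) → Bool × Bool)).card = 4 ^ (k+1) := by simp
    rw [this, Nat.sub_sub, Nat.cast_sub (by omega)]; push_cast; norm_num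
  have hrest : ‖∑ η ∈ (Finset.univ.erase η1).erase η0, f η‖ ≤ 4 ^ (k+1) - 2 := by
    rw [← hcard]
    refine (norm_sum_le _ _).trans ?_
    simp [f, norm_ex]
  rw [hsplit, h1, h0]
  have := norm_one_add_ex s hs
  have h5 : (4:ℝ) ^ (k+1) * (- (s ^ 2 / (Real.pi ^ 2 * 4 ^ (k+1))) + 1) ≤ 
     (4:ℝ) ^ (k+1) * Real.exp (- (s ^ 2 / (Real.pi ^ 2 * 4 ^ (k+1)))) :=
    mul_le_mul_of_nonneg_left (Real.add_one_le_exp _) (by positivity)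
  have h6 : (4:ℝ) ^ (k+1) * (- (s ^ 2 / (Real.pi ^ 2 * 4 ^ (k+1))) + 1) = 
      4 ^ (k+1) - s ^ 2 / Real.pi ^ 2 := by
    have := Real.pi_pos
    field_simp
    ring
  have h7 := norm_add_le (ex s + ex 0) (∑ η ∈ (Finset.univ.erase η1).erase η0, f η)
  linarith

/-- The main oscillation bound for one fixed graph. -/
lemma osc (k N : ℕ) (s : ℝ) (hs : |s| ≤ Real.pi)
    (φ : (Fin (k+1) → (Fin N → Bool)) → ℝ)
    (Q : Fin N → (Fin (k+1) → Bool × Bool) → ℝ)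
    (hφ : ∀ δ, DD (k+1) φ δ = ∑ i, Q i (fun j => ((δ j).1 i, (δ j).2 i)))
    (g : Finset (Fin N)) (hg : ∀ i ∈ g, ∀ η, Q i η = ∏ j, (gb (η j).1 - gb (η j).2)) :
    ‖∑ γ, ex (s * φ γ)‖ / ((2:ℝ) ^ N) ^ (k+1) ≤
      Real.exp (- (s ^ 2 * g.card / (Real.pi ^ 2 * 4 ^ (k+1) * 2 ^ (k+1)))) := by
  have hpi := Real.pi_pos
  have hdec := decouple k (fun γ => s * φ γ)
  have hcA : (Fintype.card (Fin N → Bool) : ℝ) = 2 ^ N := by simp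
  rw [hcA] at hdec
  have hDs : ∀ δ, DD (k+1) (fun γ => s * φ γ) δ =
      ∑ i, s * Q i (fun j => ((δ j).1 i, (δ j).2 i)) := by
    intro δ
    have hm : ∀ (k : ℕ) (c : ℝ) (φ : (Fin k → (Fin N → Bool)) → ℝ) (δ : Fin k → _ × _),
        DD k (fun r => c * φ r) δ = c * DD k φ δ := by
      intro k
      induction k with
      | zero => intro c φ δ; rfl
      | succ k ih => intro c φ δ; simp only [DD]; rw [← ih]; congr 1; funext r; ring
    rw [hm, hφ, Finset.mul_sum]
  simp_rw [hDs] at hdec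
  rw [block_prod (k+1) N (fun i η => s * Q i η)] at hdec
  have hprod : (∏ i : Fin N, ∑ η, ex (s * Q i η)).re ≤
      ∏ i : Fin N, ((4:ℝ) ^ (k+1) *
        (if i ∈ g then Real.exp (- (s ^ 2 / (Real.pi ^ 2 * 4 ^ (k+1)))) else 1)) := by
    refine (Complex.re_le_norm _).trans ?_
    rw [norm_prod]
    refine Finset.prod_le_prod (fun i _ => norm_nonneg _) fun i _ => ?_
    split_ifs with hi
    · simp_rw [hg i hi]
      exact good_block k s hs
    · refine (norm_sum_le _ _).trans ?_
      simp [norm_ex]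
  rw [Finset.prod_mul_distrib, Finset.prod_const, Finset.prod_ite_mem, Finset.univ_inter,
    Finset.prod_const, Finset.card_univ, Fintype.card_fin, ← Real.exp_nat_mul] at hprod
  have h2 : (‖∑ γ, ex (s * φ γ)‖ / ((2:ℝ) ^ N) ^ (k+1)) ^ (2 ^ (k+1)) ≤
     (Real.exp (- (s ^ 2 * g.card / (Real.pi ^ 2 * 4 ^ (k+1) * 2 ^ (k+1))))) ^ (2 ^ (k+1)) := by
    refine hdec.trans ?_
    rw [div_le_iff₀ (by positivity)]
    refine hprod.trans (le_of_eq ?_)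
    rw [← Real.exp_nat_mul, mul_comm]
    congr 1
    · congr 1
      push_cast
      field_simp
    · rw [← pow_mul, ← pow_mul, ← pow_mul, show (4:ℝ) = 2 ^ 2 by norm_num, ← pow_mul]; congr 1; ring
  exact le_of_pow_le_pow_left₀ (by positivity) (by positivity) h2

lemma tree_data {β : Type*} [Fintype β] (T : SimpleGraph β) (hT : T.Connected) (k : ℕ)
    (hk : Fintype.card β = k + 2) :
    ∃ (r : β) (ver : Fin (k+1) → β) (par : β → β) (rank : β → ℕ), Function.Injective ver ∧
      (∀ j, ver j ≠ r) ∧ (∀ b, b ≠ r → ∃ j, ver j = b) ∧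
      (∀ b, b ≠ r → T.Adj b (par b) ∧ rank (par b) < rank b) := by
  classical
  obtain ⟨r⟩ := hT.nonempty
  have hc : Fintype.card {b : β // b ≠ r} = k + 1 := by
    rw [Fintype.card_subtype_compl]; simp [hk]
  let e := (Fintype.equivFinOfCardEq hc).symm
  have hp : ∀ b, ∃ c, b ≠ r → T.Adj b c ∧ T.dist c r < T.dist b r := by
    intro b
    by_cases hb : b = r
    · exact ⟨r, fun h => absurd hb h⟩
    · obtain ⟨p, hp⟩ := hT.exists_walk_length_eq_dist b r
      cases p with
      | nil => exact absurd rfl hb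
      | cons h q =>
        rename_i c
        refine ⟨c, fun _ => ⟨h, ?_⟩⟩
        have := T.dist_le q
        simp at hp
        omega
  choose par hpar using hp
  refine ⟨r, fun j => (e j).1, par, fun b => T.dist b r, ?_, fun j => (e j).2, ?_, hpar⟩
  · intro a b h
    exact e.injective (Subtype.ext h)
  · intro b hb
    exact ⟨e.symm ⟨b, hb⟩, by simp⟩

lemma touch {β : Type*} [Fintype β] [DecidableEq β] {n N k : ℕ} (hk : Fintype.card β = k + 2) (hk1 : 1 ≤ k)
    (r : β) (ver : Fin (k+1) → β) (par : β → β) (rank : β → ℕ)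
    (hinj : Function.Injective ver) (hr : ∀ j, ver j ≠ r) (hsurj : ∀ b, b ≠ r → ∃ j, ver j = b)
    (hrank : ∀ b, b ≠ r → rank (par b) < rank b)
    (ι : Fin N × (β ⊕ (Fin (k+1) × Bool)) ↪ Fin n)
    (U : Finset (Fin n)) (hU : U.card = k + 2)
    (h : ∀ j, ∃ i, (ι (i, .inl (ver j)) ∈ U ∧ ι (i, .inl (par (ver j))) ∈ U) ∨
      (ι (i, .inr (j, false)) ∈ U ∧ ι (i, .inr (j, true)) ∈ U)) :
    ∃ i, U = Finset.univ.image (fun b => ι (i, .inl b)) := by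
  classical
  choose i hi using h
  set tr : Fin (k+1) → Prop := fun j => ι (i j, .inl (ver j)) ∈ U ∧ ι (i j, .inl (par (ver j))) ∈ U
    with htr
  have hnt : ∀ j, ¬ tr j → ι (i j, .inr (j, false)) ∈ U ∧ ι (i j, .inr (j, true)) ∈ U :=
    fun j hj => (hi j).resolve_left hj
  set f : Fin (k+1) → Fin N × (β ⊕ (Fin (k+1) × Bool)) := fun j =>
    if tr j then (i j, .inl (ver j)) else (i j, .inr (j, false)) with hf
  have hfinj : Function.Injective f := by
    intro a b hab
    simp only [hf] at hab
    split_ifs at hab <;> simp at hab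
    · exact hinj hab.2
    · exact hab.2
  have hfU : ∀ j, ι (f j) ∈ U := by
    intro j
    simp only [hf]
    split_ifs with hj
    · exact hj.1
    · exact (hnt j hj).1
  set P : Finset (Fin n) := Finset.univ.image (fun j => ι (f j)) with hP
  have hPU : P ⊆ U := by
    intro u hu
    simp only [hP, Finset.mem_image, Finset.mem_univ, true_and] at hu
    obtain ⟨j, rfl⟩ := hu
    exact hfU j
  have hPc : P.card = k + 1 := by
    rw [hP, Finset.card_image_of_injective _ (show Function.Injective (fun j => ι (f j)) from ι.injective.comp hfinj)]; simp
  have hone : (U \ P).card = 1 := by rw [Finset.card_sdiff_of_subset hPU]; omega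
  obtain ⟨u0, hu0⟩ := Finset.card_eq_one.1 hone
  have hmem : ∀ l, ι l ∈ U → (∃ j, f j = l) ∨ ι l = u0 := by
    intro l hl
    by_cases hlP : ι l ∈ P
    · left
      simp only [hP, Finset.mem_image, Finset.mem_univ, true_and] at hlP
      obtain ⟨j, hj⟩ := hlP
      exact ⟨j, ι.injective hj⟩
    · right
      have : ι l ∈ U \ P := Finset.mem_sdiff.2 ⟨hl, hlP⟩
      rw [hu0] at this
      simpa using this
  by_cases hall : ∀ j, tr j
  · have hf' : ∀ j, f j = (i j, .inl (ver j)) := fun j => by simp only [hf]; rw [if_pos (hall j)]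
    have hroot : ∀ a, ι (a, .inl r) ∈ U → ι (a, .inl r) = u0 := by
      intro a ha
      rcases hmem _ ha with ⟨j, hj⟩ | h0
      · rw [hf'] at hj
        simp at hj
        exact absurd hj.2 (hr j)
      · exact h0
    obtain ⟨js, -, hjs⟩ := Finset.exists_min_image Finset.univ (fun j => rank (ver j)) ⟨(0 : Fin (k+1)), by simp⟩
    have hjr : par (ver js) = r := by
      by_contra hne
      obtain ⟨j', hj'⟩ := hsurj _ hne
      have h1 := hjs j' (by simp)
      have h2 := hrank _ (hr js)
      rw [← hj'] at h2
      omega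
    have hu0r : ι (i js, .inl r) = u0 := hroot _ (hjr ▸ (hall js).2)
    have hind : ∀ m, ∀ j, rank (ver j) = m → ι (i j, .inl r) ∈ U := by
      intro m
      induction m using Nat.strong_induction_on with
      | _ m ih =>
        intro j hj
        by_cases hpr : par (ver j) = r
        · exact hpr ▸ (hall j).2
        · obtain ⟨j', hj'⟩ := hsurj _ hpr
          have h2 := hrank _ (hr j)
          rw [← hj'] at h2
          have h3 := ih _ (hj ▸ h2) j' rfl
          rcases hmem _ (hall j).2 with ⟨j'', hj''⟩ | h0
          · rw [hf', ← hj'] at hj''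
            simp at hj''
            rw [hinj hj''.2] at hj''
            rw [← hj''.1]; exact h3
          · rw [← hu0r] at h0
            have := ι.injective h0
            simp at this
            exact absurd this.2 hpr
    have hii : ∀ j, i j = i js := by
      intro j
      have := hroot _ (hind _ j rfl)
      rw [← hu0r] at this
      have := ι.injective this
      simp at this
      exact this
    refine ⟨i js, (Finset.eq_of_subset_of_card_le ?_ ?_).symm⟩
    · intro u hu
      simp only [Finset.mem_image, Finset.mem_univ, true_and] at hu
      obtain ⟨b, rfl⟩ := hu
      by_cases hb : b = r
      · rw [hb]; exact hind _ js rfl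
      · obtain ⟨j, rfl⟩ := hsurj b hb
        rw [← hii j]; exact (hall j).1
    · rw [Finset.card_image_of_injective, Finset.card_univ, hk, hU]
      intro a b hab
      have := ι.injective hab
      simpa using this
  · exfalso
    push Not at hall
    obtain ⟨j0, hj0⟩ := hall
    have htrue : ∀ j, ¬ tr j → ι (i j, .inr (j, true)) = u0 := by
      intro j hj
      rcases hmem _ (hnt j hj).2 with ⟨j', hj'⟩ | h0
      · simp only [hf] at hj'
        split_ifs at hj' <;> simp at hj'
      · exact h0
    have hnone : ∀ m, ∀ j, rank (ver j) = m → ¬ tr j := by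
      intro m
      induction m using Nat.strong_induction_on with
      | _ m ih =>
        intro j hj htj
        rcases hmem _ htj.2 with ⟨j', hj'⟩ | h0
        · simp only [hf] at hj'
          split_ifs at hj' with htj'
          · simp at hj'
            have h2 := hrank _ (hr j)
            rw [← hj'.2] at h2
            exact ih _ (hj ▸ h2) j' rfl htj'
          · simp at hj'
        · rw [← htrue j0 hj0] at h0
          have := ι.injective h0
          simp at this
    have : Nontrivial (Fin (k+1)) := Fin.nontrivial_iff_two_le.2 (by omega)
    obtain ⟨j1, hj1⟩ := exists_ne j0
    have h1 := htrue j1 (hnone _ j1 rfl)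
    rw [← htrue j0 hj0] at h1
    have := ι.injective h1
    simp at this
    exact hj1 this.2

lemma graphOfFn_adj {n : ℕ} (x : Sym2 (Fin n) → Bool) (u v : Fin n) :
    (graphOfFn x).Adj u v ↔ u ≠ v ∧ x s(u, v) = true := by
  simp [graphOfFn, SimpleGraph.fromRel_adj, Sym2.eq_swap (a := v) (b := u)]

open Classical in
noncomputable def ind {β : Type*} [Fintype β] (H : SimpleGraph β) {n : ℕ} (U : Finset (Fin n))
    (x : Sym2 (Fin n) → Bool) : ℝ :=
  if U.card = Fintype.card β ∧
    Nonempty (H ≃g ((graphOfFn x).induce (↑U : Set (Fin n)))) then 1 else 0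

lemma inducedCount_eq {β : Type*} [Fintype β] (H : SimpleGraph β) {n : ℕ}
    (x : Sym2 (Fin n) → Bool) :
    (inducedCount H (graphOfFn x) : ℝ) = ∑ U : Finset (Fin n), ind H U x := by
  classical
  unfold inducedCount ind
  rw [Nat.card_eq_fintype_card, Fintype.card_subtype, Finset.sum_boole]

lemma ind_congr {β : Type*} [Fintype β] (H : SimpleGraph β) {n : ℕ} (U : Finset (Fin n))
    (x y : Sym2 (Fin n) → Bool)
    (h : ∀ u ∈ U, ∀ v ∈ U, u ≠ v → x s(u, v) = y s(u, v)) : ind H U x = ind H U y := by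
  have : (graphOfFn x).induce (↑U : Set (Fin n)) = (graphOfFn y).induce (↑U : Set (Fin n)) := by
    ext ⟨u, hu⟩ ⟨v, hv⟩
    simp only [SimpleGraph.induce_adj, graphOfFn_adj]
    constructor
    · rintro ⟨h1, h2⟩; exact ⟨h1, h u hu v hv h1 ▸ h2⟩
    · rintro ⟨h1, h2⟩; exact ⟨h1, (h u hu v hv h1).symm ▸ h2⟩
  unfold ind
  rw [this]

lemma iso_le_eq {β : Type*} [Fintype β] (G H : SimpleGraph β) (hle : G ≤ H)
    (e : Nonempty (H ≃g G)) : G = H := by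
  classical
  obtain ⟨e⟩ := e
  have h1 := e.card_edgeFinset_eq
  have h2 : G.edgeFinset ⊆ H.edgeFinset := SimpleGraph.edgeFinset_mono hle
  exact SimpleGraph.edgeFinset_inj.1 (Finset.eq_of_subset_of_card_le h2 h1.le)

lemma ind_image {β : Type*} [Fintype β] [DecidableEq β] (H : SimpleGraph β) {n : ℕ} (w : β ↪ Fin n)
    (y : Sym2 (Fin n) → Bool) :
    (((∀ u v, u ≠ v → (y s(w u, w v) = true ↔ H.Adj u v))) → 
      ind H (Finset.univ.image w) y = 1) ∧
    (((∀ u v, u ≠ v → (y s(w u, w v) = true → H.Adj u v)) ∨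
      (∀ u v, u ≠ v → (H.Adj u v → y s(w u, w v) = true))) →
      (∃ u v, u ≠ v ∧ ¬ (y s(w u, w v) = true ↔ H.Adj u v)) → 
      ind H (Finset.univ.image w) y = 0) := by
  classical
  set K : SimpleGraph β := (graphOfFn y).comap w with hK
  have hKadj : ∀ u v, K.Adj u v ↔ u ≠ v ∧ y s(w u, w v) = true := by
    intro u v
    simp [hK, graphOfFn_adj]
  have hiso : Nonempty (K ≃g (graphOfFn y).induce (↑(Finset.univ.image w) : Set (Fin n))) := by
    refine ⟨⟨(Equiv.ofInjective w w.injective).trans (Equiv.setCongr (by ext; simp)), ?_⟩⟩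
    intro a b
    exact Iff.rfl
  have hc : (Finset.univ.image w).card = Fintype.card β := by
    rw [Finset.card_image_of_injective _ w.injective, Finset.card_univ]
  have hiff : Nonempty (H ≃g (graphOfFn y).induce (↑(Finset.univ.image w) : Set (Fin n))) ↔
      Nonempty (H ≃g K) := by
    obtain ⟨e⟩ := hiso
    exact ⟨fun ⟨f⟩ => ⟨f.trans e.symm⟩, fun ⟨f⟩ => ⟨f.trans e⟩⟩
  constructor
  · intro h
    have : K = H := by
      ext u v
      rw [hKadj]
      by_cases huv : u = v
      · subst huv; simp
      · rw [h u v huv]; simp [huv]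
    unfold ind
    rw [if_pos ⟨hc, hiff.2 (this ▸ ⟨SimpleGraph.Iso.refl⟩)⟩]
  · intro h ⟨u, v, huv, hne⟩
    unfold ind
    rw [if_neg]
    rintro ⟨-, hn⟩
    rw [hiff] at hn
    have : K = H := by
      rcases h with h | h
      · refine iso_le_eq K H ?_ hn
        intro a b hab
        rw [hKadj] at hab
        exact h a b hab.1 hab.2
      · refine (iso_le_eq H K ?_ ⟨hn.some.symm⟩).symm
        intro a b hab
        rw [hKadj]
        exact ⟨hab.ne, h a b hab.ne hab⟩
    apply hne
    rw [← this, hKadj]; simp [huv]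

structure BD {β : Type*} (H : SimpleGraph β) (n N k : ℕ) where
  r : β
  ver : Fin (k+1) → β
  par : β → β
  rank : β → ℕ
  hinj : Function.Injective ver
  hr : ∀ j, ver j ≠ r
  hsurj : ∀ b, b ≠ r → ∃ j, ver j = b
  hrank : ∀ b, b ≠ r → rank (par b) < rank b
  tv : Bool
  htv : ∀ b, b ≠ r → (H.Adj b (par b) ↔ tv = true)
  ι : Fin N × (β ⊕ (Fin (k+1) × Bool)) ↪ Fin n

namespace BD
variable {β : Type*} {H : SimpleGraph β} {n N k : ℕ} (B : BD H n N k)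

lemma par_ne (j : Fin (k+1)) : B.ver j ≠ B.par (B.ver j) := fun h => by
  have := B.hrank _ (B.hr j)
  rw [← h] at this
  exact lt_irrefl _ this

def slot (q : (Fin N × Fin (k+1)) × Bool) : Sym2 (Fin n) :=
  if q.2 then s(B.ι (q.1.1, .inr (q.1.2, false)), B.ι (q.1.1, .inr (q.1.2, true)))
  else s(B.ι (q.1.1, .inl (B.ver q.1.2)), B.ι (q.1.1, .inl (B.par (B.ver q.1.2))))

lemma slot_inj : Function.Injective B.slot := by
  rintro ⟨⟨i, j⟩, b⟩ ⟨⟨i', j'⟩, b'⟩ h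
  cases b <;> cases b' <;> simp [slot] at h
  · rcases h with h | h
    · have := B.hinj h.1.2
      simp [h.1.1, this]
    · exfalso
      have h1 := B.hrank _ (B.hr j)
      have h2 := B.hrank _ (B.hr j')
      rw [h.2.2] at h1
      rw [← h.1.2] at h2
      omega
  · simp [h]

lemma slot_not_diag (q) : ¬ (B.slot q).IsDiag := by
  obtain ⟨⟨i, j⟩, b⟩ := q
  cases b <;> simp [slot]
  exact B.par_ne j

def flip (γ : Fin (k+1) → Fin N → Bool) : Equiv.Perm ((Fin N × Fin (k+1)) × Bool) :=
  Function.Involutive.toPerm (fun q => (q.1, xor q.2 (γ q.1.2 q.1.1))) (by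
    intro q; simp)

noncomputable def pi (γ : Fin (k+1) → Fin N → Bool) : Equiv.Perm (Sym2 (Fin n)) :=
  (flip γ).viaEmbedding ⟨B.slot, B.slot_inj⟩

lemma pi_slot (γ) (i j b) : B.pi γ (B.slot ((i, j), b)) = B.slot ((i, j), xor b (γ j i)) :=
  Equiv.Perm.viaEmbedding_apply (flip γ) ⟨B.slot, B.slot_inj⟩ ((i, j), b)

lemma pi_not (γ) (e) (h : e ∉ Set.range B.slot) : B.pi γ e = e :=
  Equiv.Perm.viaEmbedding_apply_of_notMem (flip γ) ⟨B.slot, B.slot_inj⟩ e h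

lemma pi_diag (γ) (e) (h : e.IsDiag) : B.pi γ e = e := by
  apply B.pi_not
  rintro ⟨q, rfl⟩
  exact B.slot_not_diag q h

/-- embedding of block i -/
def w (i : Fin N) : β ↪ Fin n := ⟨fun b => B.ι (i, .inl b), fun a b h => by
  have := B.ι.injective h; simpa using this⟩

lemma w_apply (i : Fin N) (b : β) : B.w i b = B.ι (i, .inl b) := rfl

def good (x : Sym2 (Fin n) → Bool) (i : Fin N) : Prop :=
  (∀ u v, u ≠ v → (x s(B.w i u, B.w i v) = true ↔ H.Adj u v)) ∧
    ∀ j, x (B.slot ((i, j), true)) = !B.tv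

lemma slot_in_W (i : Fin N) (u v : β) (i' j b) (h : s(B.w i u, B.w i v) = B.slot ((i', j), b)) :
    i' = i ∧ b = false ∧ s(u, v) = s(B.ver j, B.par (B.ver j)) := by
  cases b <;> simp [slot, w_apply] at h
  simp
  rcases h with h | h
  · exact ⟨h.1.1.symm, Or.inl ⟨h.1.2, h.2.2⟩⟩
  · exact ⟨h.1.1.symm, Or.inr ⟨h.1.2, h.2.2⟩⟩

variable [Fintype β] [DecidableEq β]

lemma ind_W_local (x : Sym2 (Fin n) → Bool) (i : Fin N) (γ γ' : Fin (k+1) → Fin N → Bool)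
    (h : ∀ j, γ j i = γ' j i) :
    ind H (Finset.univ.image (B.w i)) (x ∘ B.pi γ) = ind H (Finset.univ.image (B.w i)) (x ∘ B.pi γ') := by
  apply ind_congr
  intro u hu v hv _
  simp only [Finset.mem_image, Finset.mem_univ, true_and] at hu hv
  obtain ⟨a, rfl⟩ := hu
  obtain ⟨b, rfl⟩ := hv
  simp only [Function.comp]
  by_cases hm : s(B.w i a, B.w i b) ∈ Set.range B.slot
  · obtain ⟨⟨⟨i', j⟩, c⟩, hq⟩ := hm
    obtain ⟨rfl, rfl, -⟩ := B.slot_in_W i a b i' j c hq.symm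
    rw [← hq, pi_slot, pi_slot, h]
  · rw [pi_not _ _ _ hm, pi_not _ _ _ hm]

lemma ind_W_good (x : Sym2 (Fin n) → Bool) (i : Fin N) (hx : B.good x i)
    (γ : Fin (k+1) → Fin N → Bool) :
    ind H (Finset.univ.image (B.w i)) (x ∘ B.pi γ) = ∏ j, gb (γ j i) := by
  by_cases hall : ∀ j, γ j i = false
  · rw [Finset.prod_eq_one (fun j _ => by simp [gb, hall j])]
    rw [B.ind_W_local x i γ (fun _ _ => false) hall]
    refine (ind_image H (B.w i) _).1 ?_
    intro u v huv
    rw [← hx.1 u v huv]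
    simp only [Function.comp]
    by_cases hm : s(B.w i u, B.w i v) ∈ Set.range B.slot
    · obtain ⟨⟨⟨i', j⟩, c⟩, hq⟩ := hm
      rw [← hq, pi_slot]; simp
    · rw [pi_not _ _ _ hm]
  · push Not at hall
    obtain ⟨j0, hj0⟩ := hall
    rw [Finset.prod_eq_zero (Finset.mem_univ j0) (by simp [gb, hj0])]
    have hval : ∀ u v, u ≠ v → (x ∘ B.pi γ) s(B.w i u, B.w i v) = x s(B.w i u, B.w i v) ∨
        ((x ∘ B.pi γ) s(B.w i u, B.w i v) = !B.tv) := by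
      intro u v huv
      simp only [Function.comp]
      by_cases hm : s(B.w i u, B.w i v) ∈ Set.range B.slot
      · obtain ⟨⟨⟨i', j⟩, c⟩, hq⟩ := hm
        obtain ⟨rfl, rfl, -⟩ := B.slot_in_W i u v i' j c hq.symm
        rw [← hq, pi_slot]
        cases hγ : γ j i'
        · left; simp
        · right; simpa using hx.2 j
      · left; rw [pi_not _ _ _ hm]
    refine (ind_image H (B.w i) _).2 ?_ ⟨B.ver j0, B.par (B.ver j0), B.par_ne j0, ?_⟩
    · cases htv : B.tv
      · right
        intro u v huv hadj
        rcases hval u v huv with h | h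
        · rw [h]; exact (hx.1 u v huv).2 hadj
        · rw [h, htv]; rfl
      · left
        intro u v huv hy
        rcases hval u v huv with h | h
        · rw [h] at hy; exact (hx.1 u v huv).1 hy
        · rw [h, htv] at hy; simp at hy
    · have hs : s(B.w i (B.ver j0), B.w i (B.par (B.ver j0))) = B.slot ((i, j0), false) := by
        simp [slot, w_apply]
      rw [B.htv _ (B.hr j0)]
      simp only [Function.comp]
      rw [hs, pi_slot]
      have : γ j0 i = true := by simpa using hj0
      rw [this]
      simp only [Bool.false_xor]
      rw [hx.2 j0]
      cases B.tv <;> simp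

lemma ind_untouched (x : Sym2 (Fin n) → Bool) (U : Finset (Fin n)) (j : Fin (k+1))
    (hj : ∀ i, ¬ ((B.ι (i, .inl (B.ver j)) ∈ U ∧ B.ι (i, .inl (B.par (B.ver j))) ∈ U) ∨
      (B.ι (i, .inr (j, false)) ∈ U ∧ B.ι (i, .inr (j, true)) ∈ U)))
    (γ γ' : Fin (k+1) → Fin N → Bool) (h : ∀ i, i ≠ j → γ i = γ' i) :
    ind H U (x ∘ B.pi γ) = ind H U (x ∘ B.pi γ') := by
  apply ind_congr
  intro u hu v hv _
  simp only [Function.comp]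
  by_cases hm : s(u, v) ∈ Set.range B.slot
  · obtain ⟨⟨⟨i', j'⟩, c⟩, hq⟩ := hm
    have hne : j' ≠ j := by
      rintro rfl
      apply hj i'
      cases c <;> simp [slot] at hq
      · left
        rcases hq with ⟨h1, h2⟩ | ⟨h1, h2⟩ <;> rw [h1, h2] <;> exact ⟨by assumption, by assumption⟩
      · right
        rcases hq with ⟨h1, h2⟩ | ⟨h1, h2⟩ <;> rw [h1, h2] <;> exact ⟨by assumption, by assumption⟩
    rw [← hq, pi_slot, pi_slot, h _ hne]
  · rw [pi_not _ _ _ hm, pi_not _ _ _ hm]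

lemma ind_card (x : Sym2 (Fin n) → Bool) (U : Finset (Fin n)) (hU : U.card ≠ Fintype.card β) :
    ind H U x = 0 := by
  unfold ind; rw [if_neg]; exact fun h => hU h.1

lemma w_image_inj : Function.Injective (fun i => Finset.univ.image (B.w i)) := by
  intro i i' h
  have : B.w i B.r ∈ Finset.univ.image (B.w i') := by
    have h' : Finset.univ.image (B.w i) = Finset.univ.image (B.w i') := h
    rw [← h']; simp
  simp only [Finset.mem_image, Finset.mem_univ, true_and] at this
  obtain ⟨b, hb⟩ := this
  have := B.ι.injective hb
  simp at this
  exact this.1.symm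

open Classical in
lemma graph_osc (hk : Fintype.card β = k + 2) (hk1 : 1 ≤ k) (x : Sym2 (Fin n) → Bool)
    (s : ℝ) (hs : |s| ≤ Real.pi) :
    ‖∑ γ : Fin (k+1) → (Fin N → Bool),
        ex (s * (inducedCount H (graphOfFn (x ∘ B.pi γ)) : ℝ))‖ / ((2:ℝ) ^ N) ^ (k+1) ≤
      Real.exp (- (s ^ 2 * (Finset.univ.filter (B.good x)).card /
        (Real.pi ^ 2 * 4 ^ (k+1) * 2 ^ (k+1)))) := by
  set R : Fin N → (Fin (k+1) → Bool) → ℝ := fun i c =>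
    ind H (Finset.univ.image (B.w i)) (x ∘ B.pi (fun j _ => c j)) with hR
  have hRloc : ∀ i (γ : Fin (k+1) → Fin N → Bool),
      ind H (Finset.univ.image (B.w i)) (x ∘ B.pi γ) = R i (fun j => γ j i) := by
    intro i γ
    exact B.ind_W_local x i _ _ (fun j => rfl)
  refine osc k N s hs (fun γ => (inducedCount H (graphOfFn (x ∘ B.pi γ)) : ℝ))
    (fun i η => DD (k+1) (R i) η) ?_ _ ?_
  · intro δ
    have h1 : (fun γ : Fin (k+1) → Fin N → Bool =>
        (inducedCount H (graphOfFn (x ∘ B.pi γ)) : ℝ)) =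
        fun γ => ∑ U : Finset (Fin n), ind H U (x ∘ B.pi γ) := by
      funext γ; exact inducedCount_eq H _
    rw [h1, DD_sum Finset.univ (k+1) (fun U γ => ind H U (x ∘ B.pi γ))]
    rw [← Finset.sum_subset (Finset.subset_univ
      (Finset.univ.image (fun i => Finset.univ.image (B.w i))))]
    · rw [Finset.sum_image (fun a _ b _ h => B.w_image_inj h)]
      refine Finset.sum_congr rfl fun i _ => ?_
      rw [← DD_map (fun a : Fin N → Bool => a i) (k+1) (R i) δ]
      congr 1
      funext γ
      exact hRloc i γ
    · intro U _ hU
      by_cases hc : U.card = Fintype.card β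
      · by_cases htouch : ∀ j, ∃ i, (B.ι (i, .inl (B.ver j)) ∈ U ∧
          B.ι (i, .inl (B.par (B.ver j))) ∈ U) ∨
          (B.ι (i, .inr (j, false)) ∈ U ∧ B.ι (i, .inr (j, true)) ∈ U)
        · exfalso
          obtain ⟨i, hi⟩ := touch hk hk1 B.r B.ver B.par B.rank B.hinj B.hr B.hsurj B.hrank B.ι U
            (hc.trans hk) htouch
          apply hU
          rw [hi]
          exact Finset.mem_image_of_mem _ (Finset.mem_univ i)
        · push Not at htouch
          obtain ⟨j, hj⟩ := htouch
          refine DD_indep (k+1) _ j ?_ δ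
          intro γ γ' hγ
          refine B.ind_untouched x U j (fun i => ?_) γ γ' hγ
          have := hj i
          tauto
      · have : (fun γ : Fin (k+1) → Fin N → Bool => ind H U (x ∘ B.pi γ)) = fun _ => 0 := by
          funext γ; exact ind_card _ U hc
        rw [this, DD_zero]
  · intro i hi η
    have hgood : B.good x i := by simpa using hi
    have : R i = fun c => ∏ j, gb (c j) := by
      funext c
      exact B.ind_W_good x i hgood (fun j _ => c j)
    simp only [this]
    exact DD_prod (k+1) (fun _ b => gb b) η

end BD

section conc
variable {E : Type*} [Fintype E] [DecidableEq E]

noncomputable def wt (D : E → Prop) [DecidablePred D] (p : ℝ) (e : E) (b : Bool) : ℝ :=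
  if D e then (if b then 0 else 1) else (if b then p else 1 - p)

variable (D : E → Prop) [DecidablePred D] (p : ℝ)

lemma wt_sum (e : E) : ∑ b, wt D p e b = 1 := by
  unfold wt; split_ifs <;> simp

lemma wt_nonneg (hp : 0 ≤ p) (hp1 : p ≤ 1) (e : E) (b : Bool) : 0 ≤ wt D p e b := by
  unfold wt; split_ifs <;> linarith

lemma exp_match (τ : E → Bool) (s : Finset E) :
    ∑ x : E → Bool, (∏ e, wt D p e (x e)) * (if ∀ e ∈ s, x e = τ e then (1:ℝ) else 0) =
      ∏ e ∈ s, wt D p e (τ e) := by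
  have h1 : ∀ x : E → Bool, (∏ e, wt D p e (x e)) * (if ∀ e ∈ s, x e = τ e then (1:ℝ) else 0) =
      ∏ e, (wt D p e (x e) * (if e ∈ s → x e = τ e then 1 else 0)) := by
    intro x
    rw [Finset.prod_mul_distrib]
    congr 1
    rw [Finset.prod_boole]
    simp
  simp_rw [h1]
  have h2 := Finset.prod_univ_sum (fun _ : E => (Finset.univ : Finset Bool))
    (fun e b => wt D p e b * (if e ∈ s → b = τ e then (1:ℝ) else 0))
  rw [Fintype.piFinset_univ] at h2
  rw [← h2]
  have h3 : ∀ e, ∑ b, wt D p e b * (if e ∈ s → b = τ e then (1:ℝ) else 0) =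
      if e ∈ s then wt D p e (τ e) else 1 := by
    intro e
    by_cases he : e ∈ s
    · simp [he]
    · simp only [he, false_imp_iff, if_true, mul_one, if_false]
      exact wt_sum D p e
  simp_rw [h3]
  rw [Finset.prod_ite_mem, Finset.univ_inter]

lemma exp_prod {N : ℕ} (τ : E → Bool) (bl : Fin N → Finset E)
    (hd : ∀ i i', i ≠ i' → Disjoint (bl i) (bl i')) (c : ℝ) :
    ∑ x : E → Bool, (∏ e, wt D p e (x e)) *
      ∏ i, (1 + c * (if ∀ e ∈ bl i, x e = τ e then (1:ℝ) else 0)) =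
    ∏ i, (1 + c * ∏ e ∈ bl i, wt D p e (τ e)) := by
  simp_rw [Finset.prod_one_add, Finset.mul_sum]
  rw [Finset.sum_comm]
  refine Finset.sum_congr rfl fun t _ => ?_
  simp_rw [Finset.prod_mul_distrib]
  have h1 := exp_match D p τ (t.biUnion bl)
  rw [Finset.prod_biUnion (fun i _ j _ hij => hd i j hij)] at h1
  rw [← h1, Finset.mul_sum]
  refine Finset.sum_congr rfl fun x _ => ?_
  rw [Finset.prod_boole]
  have : (∀ e ∈ t.biUnion bl, x e = τ e) ↔ ∀ i ∈ t, ∀ e ∈ bl i, x e = τ e := by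
    simp only [Finset.mem_biUnion]
    constructor
    · intro h i hi e he; exact h e ⟨i, hi, he⟩
    · rintro h e ⟨i, hi, he⟩; exact h i hi e he
  simp only [this]
  ring

lemma conc_bound {N : ℕ} (hp : 0 ≤ p) (hp1 : p ≤ 1) (τ : E → Bool) (bl : Fin N → Finset E)
    (hd : ∀ i i', i ≠ i' → Disjoint (bl i) (bl i')) (q : ℝ)
    (hq : ∀ i, q ≤ ∏ e ∈ bl i, wt D p e (τ e)) :
    ∑ x : E → Bool, (if ((Finset.univ.filter fun i => ∀ e ∈ bl i, x e = τ e).card : ℝ) ≤ q / 4 * N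
      then ∏ e, wt D p e (x e) else 0) ≤ Real.exp (- (q / 4 * N)) := by
  set c : ℝ := Real.exp (-1) - 1 with hc
  have hc2 : c ≤ -1/2 := by
    have := Real.exp_neg_one_lt_half
    rw [hc]; linarith
  have hW : ∀ x : E → Bool, 0 ≤ ∏ e, wt D p e (x e) := fun x =>
    Finset.prod_nonneg fun e _ => wt_nonneg D p hp hp1 e _
  have h1 : ∀ x : E → Bool,
      (if ((Finset.univ.filter fun i => ∀ e ∈ bl i, x e = τ e).card : ℝ) ≤ q / 4 * N
        then ∏ e, wt D p e (x e) else 0) ≤ Real.exp (q / 4 * N) * ((∏ e, wt D p e (x e)) *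
      ∏ i, (1 + c * (if ∀ e ∈ bl i, x e = τ e then (1:ℝ) else 0))) := by
    intro x
    have h2 : ∏ i, (1 + c * (if ∀ e ∈ bl i, x e = τ e then (1:ℝ) else 0)) =
        Real.exp (-((Finset.univ.filter fun i => ∀ e ∈ bl i, x e = τ e).card : ℝ)) := by
      have : ∀ i, (1 + c * (if ∀ e ∈ bl i, x e = τ e then (1:ℝ) else 0)) =
          if ∀ e ∈ bl i, x e = τ e then Real.exp (-1) else 1 := by
        intro i; split_ifs
        · rw [hc]; ring
        · ring
      simp_rw [this]
      rw [Finset.prod_ite, Finset.prod_const, Finset.prod_const_one, mul_one, ← Real.exp_nat_mul]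
      congr 1; ring
    rw [h2]
    split_ifs with h
    · have h3 : 1 ≤ Real.exp (q / 4 * N) *
          Real.exp (-((Finset.univ.filter fun i => ∀ e ∈ bl i, x e = τ e).card : ℝ)) := by
        rw [← Real.exp_add]
        apply Real.one_le_exp
        linarith
      nlinarith [hW x]
    · have := hW x
      positivity
  refine (Finset.sum_le_sum fun x _ => h1 x).trans ?_
  rw [← Finset.mul_sum, exp_prod D p τ bl hd c]
  have h4 : ∏ i, (1 + c * ∏ e ∈ bl i, wt D p e (τ e)) ≤ ∏ i : Fin N, Real.exp (-(q / 2)) := by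
    refine Finset.prod_le_prod (fun i _ => ?_) (fun i _ => ?_)
    · have : ∏ e ∈ bl i, wt D p e (τ e) ≤ 1 := by
        refine Finset.prod_le_one (fun e _ => wt_nonneg D p hp hp1 e _) (fun e _ => ?_)
        unfold wt; split_ifs <;> linarith
      have h0 : 0 ≤ ∏ e ∈ bl i, wt D p e (τ e) :=
        Finset.prod_nonneg (fun e _ => wt_nonneg D p hp hp1 e _)
      have := Real.exp_pos (-1)
      nlinarith
    · have h0 : 0 ≤ ∏ e ∈ bl i, wt D p e (τ e) :=
        Finset.prod_nonneg (fun e _ => wt_nonneg D p hp hp1 e _)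
      have := Real.add_one_le_exp (-(q/2))
      nlinarith [hq i]
  calc _ ≤ Real.exp (q / 4 * N) * ∏ i : Fin N, Real.exp (-(q / 2)) :=
        mul_le_mul_of_nonneg_left h4 (by positivity)
    _ = _ := by
        rw [Finset.prod_const, ← Real.exp_nat_mul, ← Real.exp_add]
        congr 1
        simp; ring

end conc

lemma binom_mode (M m : ℕ) (hM : 0 < M) (hm : m ≤ M) (p : ℝ) (hp : p = m / M) (hp0 : 0 < p)
    (hp1 : p < 1) :
    1 ≤ ((M:ℝ) + 1) * ((M.choose m : ℝ) * (p ^ m * (1 - p) ^ (M - m))) := by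
  set b : ℕ → ℝ := fun k => (M.choose k : ℝ) * (p ^ k * (1 - p) ^ (M - k)) with hb
  have hMp : (M:ℝ) * p = m := by rw [hp]; field_simp
  have hM0 : (0:ℝ) < M := by exact_mod_cast hM
  have hb0 : ∀ k, 0 ≤ b k := fun k => by
    have : 0 < 1 - p := by linarith
    positivity
  have hsum : ∑ k ∈ Finset.range (M+1), b k = 1 := by
    have := add_pow p (1-p) M
    rw [show p + (1 - p) = 1 by ring, one_pow] at this
    rw [this]
    refine Finset.sum_congr rfl fun k _ => ?_
    simp only [hb]; ring
  have hratio : ∀ k, k + 1 ≤ M → b (k+1) * ((k + 1) * (1 - p)) = b k * ((M - k) * p) := by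
    intro k hk
    have h1 : ((M.choose (k+1) : ℝ)) * (k+1) = (M.choose k : ℝ) * (M - k) := by
      have := Nat.choose_succ_right_eq M k
      have h2 : ((M - k : ℕ) : ℝ) = M - k := by rw [Nat.cast_sub (by omega)]
      rw [← h2]; exact_mod_cast this
    have h2 : M - k = (M - (k+1)) + 1 := by omega
    simp only [hb]
    rw [h2, pow_succ, pow_succ]
    linear_combination (p ^ k * p * ((1 - p) ^ (M - (k+1)) * (1 - p))) * h1
  have hup : ∀ k, k + 1 ≤ m → b k ≤ b (k+1) := by
    intro k hk
    have h1 := hratio k (hk.trans hm)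
    have hk' : (k:ℝ) + 1 ≤ m := by exact_mod_cast hk
    have h2 : ((k:ℝ) + 1) * (1 - p) ≤ (M - k) * p := by nlinarith
    have h3 : 0 < ((k:ℝ) + 1) * (1 - p) := by
      have : 0 < 1 - p := by linarith
      positivity
    have h4 := mul_le_mul_of_nonneg_left h2 (hb0 k)
    rw [← h1] at h4
    exact le_of_mul_le_mul_right h4 h3
  have hdown : ∀ k, m ≤ k → k + 1 ≤ M → b (k+1) ≤ b k := by
    intro k hk hkM
    have h1 := hratio k hkM
    have hk' : (m:ℝ) ≤ k := by exact_mod_cast hk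
    have h2 : (M - k) * p ≤ ((k:ℝ) + 1) * (1 - p) := by nlinarith
    have h3 : 0 < ((k:ℝ) + 1) * (1 - p) := by
      have : 0 < 1 - p := by linarith
      positivity
    have h4 := mul_le_mul_of_nonneg_left h2 (hb0 k)
    rw [← h1] at h4
    exact le_of_mul_le_mul_right h4 h3
  have hle1 : ∀ d, d ≤ m → b (m - d) ≤ b m := by
    intro d
    induction d with
    | zero => intro _; simp
    | succ d ih =>
      intro hd
      refine le_trans ?_ (ih (by omega))
      have := hup (m - (d+1)) (by omega)
      rwa [show m - (d+1) + 1 = m - d by omega] at this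
  have hle2 : ∀ d, m + d ≤ M → b (m + d) ≤ b m := by
    intro d
    induction d with
    | zero => intro _; simp
    | succ d ih =>
      intro hd
      exact (hdown (m + d) (by omega) (by omega)).trans (ih (by omega))
  have hall : ∀ k ∈ Finset.range (M+1), b k ≤ b m := by
    intro k hk
    have hk' := Finset.mem_range.1 hk
    rcases le_total k m with h | h
    · have := hle1 (m - k) (by omega)
      rwa [show m - (m - k) = k by omega] at this
    · have := hle2 (k - m) (by omega)
      rwa [show m + (k - m) = k by omega] at this
  have := Finset.sum_le_card_nsmul _ _ _ hall
  rw [hsum] at this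
  simpa using this

open Classical in
noncomputable def SS (n m : ℕ) : Finset (Sym2 (Fin n) → Bool) :=
  Finset.univ.filter fun x => (∀ e : Sym2 (Fin n), e.IsDiag → x e = false) ∧
    (Finset.univ.filter fun e : Sym2 (Fin n) => x e = true).card = m

lemma mem_SS {n m : ℕ} {x : Sym2 (Fin n) → Bool} : x ∈ SS n m ↔
    (∀ e : Sym2 (Fin n), e.IsDiag → x e = false) ∧
    (Finset.univ.filter fun e : Sym2 (Fin n) => x e = true).card = m := by
  simp [SS]

lemma card_nondiag (n : ℕ) :
    (Finset.univ.filter fun e : Sym2 (Fin n) => ¬ e.IsDiag).card = n.choose 2 := by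
  have := Sym2.card_subtype_not_diag (α := Fin n)
  rw [Fintype.card_subtype, Fintype.card_fin] at this
  exact this

lemma card_SS (n m : ℕ) : (SS n m).card = (n.choose 2).choose m := by
  classical
  rw [← card_nondiag n, ← Finset.card_powersetCard]
  refine Finset.card_nbij' (fun x => Finset.univ.filter fun e => x e = true)
    (fun t e => decide (e ∈ t)) ?_ ?_ ?_ ?_
  · intro x hx
    have hx := mem_SS.1 hx
    simp only [Finset.mem_coe, Finset.mem_powersetCard]
    refine ⟨fun e he => ?_, hx.2⟩
    simp only [Finset.mem_filter, Finset.mem_univ, true_and] at he ⊢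
    intro hd
    rw [hx.1 e hd] at he
    exact absurd he (by simp)
  · intro t ht
    simp only [Finset.mem_coe, Finset.mem_powersetCard] at ht
    refine Finset.mem_coe.2 (mem_SS.2 ⟨fun e he => ?_, ?_⟩)
    · simp only [decide_eq_false_iff_not]
      intro h
      have := ht.1 h
      simp at this
      exact this he
    · simpa using ht.2
  · intro x _
    funext e
    simp
  · intro t _
    ext e
    simp

lemma wt_SS {n m : ℕ} (p : ℝ) (x : Sym2 (Fin n) → Bool) (hx : x ∈ SS n m) :
    ∏ e, wt (fun e : Sym2 (Fin n) => e.IsDiag) p e (x e) = p ^ m * (1 - p) ^ (n.choose 2 - m) := by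
  classical
  obtain ⟨h1, h2⟩ := mem_SS.1 hx
  have h3 : ∀ e, wt (fun e : Sym2 (Fin n) => e.IsDiag) p e (x e) =
      (if x e = true then p else 1) * (if ¬ e.IsDiag ∧ ¬ x e = true then 1 - p else 1) := by
    intro e
    unfold wt
    by_cases hd : e.IsDiag
    · simp [hd, h1 e hd]
    · cases hxe : x e <;> simp [hd]
  simp_rw [h3]
  rw [Finset.prod_mul_distrib, Finset.prod_ite, Finset.prod_ite]
  simp only [Finset.prod_const, one_pow, mul_one, h2]
  congr 2
  rw [← card_nondiag n, ← h2]
  have : (Finset.univ.filter fun e : Sym2 (Fin n) => ¬ e.IsDiag ∧ ¬ x e = true) =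
    (Finset.univ.filter fun e : Sym2 (Fin n) => ¬ e.IsDiag) \
      (Finset.univ.filter fun e : Sym2 (Fin n) => x e = true) := by
    ext e; simp
  rw [this, Finset.card_sdiff_of_subset]
  intro e he
  simp only [Finset.mem_filter, Finset.mem_univ, true_and] at he ⊢
  intro hd
  rw [h1 e hd] at he
  exact absurd he (by simp)

namespace BD
variable {β : Type*} {H : SimpleGraph β} {n N k : ℕ} (B : BD H n N k)

open Classical in
noncomputable def tau : Sym2 (Fin n) → Bool := fun e =>
  decide ((∃ i u v, H.Adj u v ∧ e = s(B.w i u, B.w i v)) ∨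
    (∃ i j, e = B.slot ((i, j), true) ∧ B.tv = false))

lemma tau_W (i) (u v : β) : B.tau s(B.w i u, B.w i v) = true ↔ H.Adj u v := by
  simp only [tau, decide_eq_true_eq]
  constructor
  · rintro (⟨i', u', v', ha, he⟩ | ⟨i', j, he, -⟩)
    · simp [w_apply] at he
      rcases he with ⟨⟨-, rfl⟩, ⟨-, rfl⟩⟩ | ⟨⟨-, rfl⟩, ⟨-, rfl⟩⟩
      · exact ha
      · exact ha.symm
    · have := (B.slot_in_W i u v i' j true he).2.1
      simp at this
  · intro h
    exact Or.inl ⟨i, u, v, h, rfl⟩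

lemma tau_slot (i j) : B.tau (B.slot ((i, j), true)) = !B.tv := by
  rw [Bool.eq_iff_iff]
  simp only [tau, decide_eq_true_eq]
  constructor
  · rintro (⟨i', u', v', ha, he⟩ | ⟨i', j, he, h⟩)
    · have := (B.slot_in_W i' u' v' i j true he.symm).2.1
      simp at this
    · simp [h]
  · intro h
    exact Or.inr ⟨i, j, rfl, by simpa using h⟩

variable [Fintype β] [DecidableEq β]

def blk (i : Fin N) : Finset (Sym2 (Fin n)) :=
  ((Finset.univ.filter fun q : β × β => q.1 ≠ q.2).image fun q => s(B.w i q.1, B.w i q.2)) ∪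
    Finset.univ.image fun j => B.slot ((i, j), true)

lemma good_of_match (x : Sym2 (Fin n) → Bool) (i : Fin N) (h : ∀ e ∈ B.blk i, x e = B.tau e) :
    B.good x i := by
  constructor
  · intro u v huv
    rw [h, tau_W]
    apply Finset.mem_union_left
    exact Finset.mem_image.2 ⟨(u, v), by simpa using huv, rfl⟩
  · intro j
    rw [h, tau_slot]
    apply Finset.mem_union_right
    exact Finset.mem_image.2 ⟨j, by simp, rfl⟩

lemma blk_mem (i : Fin N) (e) (he : e ∈ B.blk i) : ∀ v ∈ e, ∃ l, v = B.ι (i, l) := by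
  intro v hv
  rcases Finset.mem_union.1 he with he | he
  · obtain ⟨q, -, rfl⟩ := Finset.mem_image.1 he
    simp [w_apply] at hv
    rcases hv with rfl | rfl <;> exact ⟨_, rfl⟩
  · obtain ⟨q, -, rfl⟩ := Finset.mem_image.1 he
    simp [slot] at hv
    rcases hv with rfl | rfl <;> exact ⟨_, rfl⟩

lemma blk_disj (i i' : Fin N) (h : i ≠ i') : Disjoint (B.blk i) (B.blk i') := by
  rw [Finset.disjoint_left]
  intro e he he'
  induction e using Sym2.inductionOn with
  | _ a b =>
    obtain ⟨l, hl⟩ := B.blk_mem i _ he a (by simp)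
    obtain ⟨l', hl'⟩ := B.blk_mem i' _ he' a (by simp)
    rw [hl] at hl'
    have := B.ι.injective hl'
    simp at this
    exact h this.1

lemma blk_nd (i : Fin N) (e) (he : e ∈ B.blk i) : ¬ e.IsDiag := by
  rcases Finset.mem_union.1 he with he | he
  · obtain ⟨q, hq, rfl⟩ := Finset.mem_image.1 he
    simpa using hq
  · obtain ⟨q, -, rfl⟩ := Finset.mem_image.1 he
    exact B.slot_not_diag _

lemma blk_card (i : Fin N) : (B.blk i).card ≤ Fintype.card β ^ 2 + (k + 1) := by
  refine (Finset.card_union_le _ _).trans (Nat.add_le_add ?_ ?_)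
  · refine Finset.card_image_le.trans ((Finset.card_filter_le _ _).trans ?_)
    simp [sq]
  · refine Finset.card_image_le.trans ?_
    simp

open Classical in
lemma bad_frac (m : ℕ) (hM : 0 < n.choose 2) (lam : ℝ) (hl : 0 < lam)
    (hp : (m : ℝ) / (n.choose 2) ∈ Set.Ioo lam (1 - lam)) (q : ℝ)
    (hq : q = lam ^ (Fintype.card β ^ 2 + (k + 1))) :
    (((SS n m).filter fun x => ((Finset.univ.filter (B.good x)).card : ℝ) ≤ q / 4 * N).card : ℝ) ≤
      ((n.choose 2 : ℝ) + 1) * Real.exp (- (q / 4 * N)) * (SS n m).card := by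
  set p : ℝ := (m : ℝ) / (n.choose 2) with hpdef
  set M := n.choose 2 with hMdef
  have hM0 : (0:ℝ) < M := by exact_mod_cast hM
  obtain ⟨hp1, hp2⟩ := hp
  have hmM : m ≤ M := by
    have : (m:ℝ) / M < 1 := by linarith
    rw [div_lt_one hM0] at this
    exact_mod_cast this.le
  have hmode := binom_mode M m hM hmM p rfl (by linarith) (by linarith)
  have hconc := conc_bound (fun e : Sym2 (Fin n) => e.IsDiag) p (by linarith) (by linarith) B.tau
    B.blk B.blk_disj q (by
      intro i
      rw [hq]
      calc lam ^ (Fintype.card β ^ 2 + (k + 1)) ≤ lam ^ (B.blk i).card :=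
            pow_le_pow_of_le_one hl.le (by linarith) (B.blk_card i)
        _ = ∏ e ∈ B.blk i, lam := by rw [Finset.prod_const]
        _ ≤ _ := by
            refine Finset.prod_le_prod (fun _ _ => hl.le) fun e he => ?_
            unfold wt
            rw [if_neg (B.blk_nd i e he)]
            split_ifs <;> linarith)
  set w0 := p ^ m * (1 - p) ^ (M - m) with hw0
  have hw0pos : 0 ≤ w0 := by
    have : 0 < p := by linarith
    have : 0 < 1 - p := by linarith
    positivity
  set bad := (SS n m).filter fun x => ((Finset.univ.filter (B.good x)).card : ℝ) ≤ q / 4 * N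
  have hcount : (bad.card : ℝ) * w0 ≤ Real.exp (- (q / 4 * N)) := by
    refine le_trans ?_ hconc
    rw [← nsmul_eq_mul, ← Finset.sum_const]
    refine le_trans ?_ (Finset.sum_le_sum_of_subset_of_nonneg (Finset.subset_univ bad) ?_)
    · refine Finset.sum_le_sum fun x hx => ?_
      obtain ⟨hxS, hxb⟩ := Finset.mem_filter.1 hx
      rw [if_pos, wt_SS p x hxS]
      refine le_trans ?_ hxb
      exact_mod_cast Finset.card_le_card (fun i hi => by
        simp only [Finset.mem_filter, Finset.mem_univ, true_and] at hi ⊢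
        exact B.good_of_match x i hi)
    · intro x _ _
      split_ifs
      · exact Finset.prod_nonneg fun e _ => wt_nonneg _ p (by linarith) (by linarith) e _
      · exact le_rfl
  rw [← card_SS n m] at hmode
  have hb0 : (0:ℝ) ≤ bad.card := by positivity
  have hS0 : (0:ℝ) ≤ (SS n m).card := by positivity
  calc (bad.card : ℝ) = bad.card * 1 := by ring
    _ ≤ bad.card * (((M:ℝ) + 1) * (((SS n m).card : ℝ) * w0)) :=
        mul_le_mul_of_nonneg_left hmode hb0
    _ = ((M:ℝ) + 1) * (SS n m).card * (bad.card * w0) := by ring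
    _ ≤ ((M:ℝ) + 1) * (SS n m).card * Real.exp (- (q / 4 * N)) :=
        mul_le_mul_of_nonneg_left hcount (by positivity)
    _ = _ := by ring

lemma SS_pi (m : ℕ) (γ) (x : Sym2 (Fin n) → Bool) (hx : x ∈ SS n m) : x ∘ B.pi γ ∈ SS n m := by
  obtain ⟨h1, h2⟩ := mem_SS.1 hx
  refine mem_SS.2 ⟨fun e he => ?_, ?_⟩
  · simp only [Function.comp]
    rw [B.pi_diag γ e he]; exact h1 e he
  · rw [← h2]
    refine Finset.card_bij (fun e _ => B.pi γ e) ?_ ?_ ?_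
    · intro e he; simpa using he
    · intro a _ b _ h; exact (B.pi γ).injective h
    · intro e he
      exact ⟨(B.pi γ).symm e, by simpa using he, by simp⟩

lemma sum_pi (m : ℕ) (γ) (f : (Sym2 (Fin n) → Bool) → ℂ) :
    ∑ x ∈ SS n m, f (x ∘ B.pi γ) = ∑ x ∈ SS n m, f x := by
  have hinj : Function.Injective (fun x : Sym2 (Fin n) → Bool => x ∘ B.pi γ) := by
    intro x y h
    funext e
    have := congrFun h ((B.pi γ).symm e)
    simpa using this
  have hbij : (SS n m).image (fun x => x ∘ B.pi γ) = SS n m := by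
    apply Finset.eq_of_subset_of_card_le
    · intro y hy
      obtain ⟨x, hx, rfl⟩ := Finset.mem_image.1 hy
      exact B.SS_pi m γ x hx
    · rw [Finset.card_image_of_injective _ hinj]
  conv_rhs => rw [← hbij]
  rw [Finset.sum_image (fun a _ b _ h => hinj h)]

/-- main bound over `G(n,m)` -/
lemma main_bound (B : BD H n N k) (hk : Fintype.card β = k + 2) (hk1 : 1 ≤ k) (m : ℕ) (hM : 0 < n.choose 2)
    (lam : ℝ) (hl : 0 < lam)
    (hp : (m : ℝ) / (n.choose 2) ∈ Set.Ioo lam (1 - lam)) (q : ℝ)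
    (hq : q = lam ^ (Fintype.card β ^ 2 + (k + 1))) (s : ℝ) (hs : |s| ≤ Real.pi) :
    ‖∑ x ∈ SS n m, ex (s * (inducedCount H (graphOfFn x) : ℝ))‖ ≤
      (((n.choose 2 : ℝ) + 1) * Real.exp (- (q / 4 * N)) +
        Real.exp (- (s ^ 2 * (q / 4 * N) / (Real.pi ^ 2 * 4 ^ (k+1) * 2 ^ (k+1))))) *
        (SS n m).card := by
  classical
  set f : (Sym2 (Fin n) → Bool) → ℂ := fun x => ex (s * (inducedCount H (graphOfFn x) : ℝ)) with hf
  set A : ℝ := ((2:ℝ) ^ N) ^ (k+1) with hA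
  have hApos : 0 < A := by positivity
  set ρ : ℝ := Real.exp (- (s ^ 2 * (q / 4 * N) / (Real.pi ^ 2 * 4 ^ (k+1) * 2 ^ (k+1)))) with hρ
  set bad := (SS n m).filter fun x => ((Finset.univ.filter (B.good x)).card : ℝ) ≤ q / 4 * N
    with hbad
  have hcardγ : ((Finset.univ : Finset (Fin (k+1) → Fin N → Bool)).card : ℝ) = A := by
    simp [hA]
  have h1 : (A : ℂ) * ∑ x ∈ SS n m, f x =
      ∑ x ∈ SS n m, ∑ γ : Fin (k+1) → Fin N → Bool, f (x ∘ B.pi γ) := by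
    rw [Finset.sum_comm]
    simp_rw [B.sum_pi m _ f]
    rw [Finset.sum_const, nsmul_eq_mul, ← hcardγ]
    push_cast; rfl
  have hpt : ∀ x ∈ SS n m, ‖∑ γ : Fin (k+1) → Fin N → Bool, f (x ∘ B.pi γ)‖ ≤
      A * ((if x ∈ bad then 1 else 0) + ρ) := by
    intro x hx
    split_ifs with hb
    · refine (norm_sum_le _ _).trans ?_
      simp only [hf, norm_ex]
      rw [Finset.sum_const, nsmul_eq_mul, mul_one, hcardγ]
      have : 0 < ρ := Real.exp_pos _
      nlinarith
    · have hg : q / 4 * N ≤ ((Finset.univ.filter (B.good x)).card : ℝ) := by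
        by_contra hlt
        exact hb (Finset.mem_filter.2 ⟨hx, (not_le.1 hlt).le⟩)
      have := B.graph_osc hk hk1 x s hs
      rw [div_le_iff₀ hApos] at this
      refine this.trans ?_
      rw [zero_add, mul_comm]
      refine mul_le_mul_of_nonneg_left ?_ hApos.le
      rw [hρ]
      apply Real.exp_le_exp.2
      apply neg_le_neg
      have := Real.pi_pos
      gcongr
  have h2 : A * ‖∑ x ∈ SS n m, f x‖ ≤ A * (bad.card + ρ * (SS n m).card) := by
    have : A * ‖∑ x ∈ SS n m, f x‖ = ‖(A : ℂ) * ∑ x ∈ SS n m, f x‖ := by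
      rw [norm_mul, Complex.norm_real, Real.norm_of_nonneg hApos.le]
    rw [this, h1]
    refine (norm_sum_le _ _).trans ((Finset.sum_le_sum hpt).trans (le_of_eq ?_))
    rw [← Finset.mul_sum, Finset.sum_add_distrib, Finset.sum_const, nsmul_eq_mul, Finset.sum_boole]
    have : (SS n m).filter (fun x => x ∈ bad) = bad := by
      ext x; simp [hbad]
    rw [this]; ring
  have h3 := le_of_mul_le_mul_left h2 hApos
  have h4 := B.bad_frac m hM lam hl hp q hq
  calc _ ≤ _ := h3
    _ ≤ _ := by rw [add_mul]; linarith

end BD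

open MeasureTheory

lemma int_gnm (n m : ℕ) (f : (Sym2 (Fin n) → Bool) → ℂ) :
    ∫ x, f x ∂(gnm n m) = ((SS n m).card : ℂ)⁻¹ * ∑ x ∈ SS n m, f x := by
  classical
  unfold gnm finUniform
  rw [integral_smul_measure, integral_finset_sum_measure]
  · simp only [integral_smul_measure, integral_dirac]
    have hc : Nat.card ({x | (∀ e : Sym2 (Fin n), e.IsDiag → x e = false) ∧
      (Finset.univ.filter fun e : Sym2 (Fin n) => x e = true).card = m} :
        Set (Sym2 (Fin n) → Bool)) = (SS n m).card := by
      rw [Nat.card_eq_fintype_card, Fintype.card_subtype]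
      congr 1
    rw [hc]
    have : ∀ x : Sym2 (Fin n) → Bool, (Set.indicator {x | (∀ e : Sym2 (Fin n), e.IsDiag → x e = false) ∧
      (Finset.univ.filter fun e : Sym2 (Fin n) => x e = true).card = m}
        (fun _ => (1 : ENNReal)) x).toReal • f x = if x ∈ SS n m then f x else 0 := by
      intro x
      by_cases hx : x ∈ SS n m
      · rw [if_pos hx, Set.indicator_of_mem (by exact mem_SS.1 hx)]; simp
      · rw [if_neg hx, Set.indicator_of_notMem (by intro h; exact hx (mem_SS.2 h))]; simp
    simp_rw [this]
    rw [Finset.sum_ite_mem, Finset.univ_inter]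
    simp
  · intro i _
    refine ((integrable_dirac (by simp)).smul_measure ?_)
    by_cases h : i ∈ {x : Sym2 (Fin n) → Bool | (∀ e : Sym2 (Fin n), e.IsDiag → x e = false) ∧
      (Finset.univ.filter fun e : Sym2 (Fin n) => x e = true).card = m}
    · rw [Set.indicator_of_mem h]; simp
    · rw [Set.indicator_of_notMem h]; simp

lemma int_gnp (n : ℕ) (p : ℝ) (f : (Sym2 (Fin n) → Bool) → ℝ) :
    ∫ x, f x ∂(gnp n p) =
      ∑ x, (∏ i : Sym2 (Fin n), ENNReal.ofReal (if x i then p else 1 - p)).toReal * f x := by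
  classical
  unfold gnp bernoulliPi
  rw [integral_finset_sum_measure]
  · simp only [integral_smul_measure, integral_dirac, smul_eq_mul]
  · intro i _
    refine ((integrable_dirac (by simp)).smul_measure ?_)
    exact ENNReal.prod_ne_top fun _ _ => ENNReal.ofReal_ne_top

lemma int_gnp_perm (n : ℕ) (p : ℝ) (f : (Sym2 (Fin n) → Bool) → ℝ) (τ : Equiv.Perm (Sym2 (Fin n))) :
    ∫ x, f (x ∘ τ) ∂(gnp n p) = ∫ x, f x ∂(gnp n p) := by
  rw [int_gnp, int_gnp]
  refine Fintype.sum_equiv (Equiv.arrowCongr τ.symm (Equiv.refl Bool)) _ _ fun x => ?_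
  have : (Equiv.arrowCongr τ.symm (Equiv.refl Bool)) x = x ∘ τ := by
    funext e; simp [Equiv.arrowCongr]
  rw [this]
  congr 2
  exact (Equiv.prod_comp τ fun i => ENNReal.ofReal (if x i then p else 1 - p)).symm

lemma inducedCount_iso {β : Type*} [Fintype β] (H : SimpleGraph β) {n : ℕ}
    (G G' : SimpleGraph (Fin n)) (e : G ≃g G') : inducedCount H G = inducedCount H G' := by
  classical
  have key : ∀ (G G' : SimpleGraph (Fin n)) (e : G ≃g G') (U : Finset (Fin n)),
      (U.card = Fintype.card β ∧ Nonempty (H ≃g (G.induce (↑U : Set (Fin n))))) →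
      ((U.map e.toEquiv.toEmbedding).card = Fintype.card β ∧
        Nonempty (H ≃g (G'.induce (↑(U.map e.toEquiv.toEmbedding) : Set (Fin n))))) := by
    rintro G G' e U ⟨h1, ⟨f⟩⟩
    refine ⟨by simpa using h1, ⟨f.trans ?_⟩⟩
    refine ⟨(e.toEquiv.image U).trans (Equiv.setCongr (by simp)), ?_⟩
    intro a b
    exact e.map_rel_iff
  unfold inducedCount
  refine Nat.card_congr (Equiv.subtypeEquiv (Equiv.finsetCongr e.toEquiv) fun U => ⟨key G G' e U, ?_⟩)
  intro h
  have := key G' G e.symm _ h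
  have h2 : ((Equiv.finsetCongr e.toEquiv) U).map e.symm.toEquiv.toEmbedding = U := by
    ext a
    simp only [Finset.mem_map_equiv, Equiv.finsetCongr_apply]
    have : e.toEquiv.symm (e.symm.toEquiv.symm a) = a := e.symm_apply_apply a
    rw [this]
  rw [h2] at this
  exact this

def s2perm {n : ℕ} (σ : Equiv.Perm (Fin n)) : Equiv.Perm (Sym2 (Fin n)) where
  toFun := Sym2.map σ
  invFun := Sym2.map σ.symm
  left_inv e := by rw [Sym2.map_map]; simp
  right_inv e := by rw [Sym2.map_map]; simp

@[simp] lemma s2perm_mk {n : ℕ} (σ : Equiv.Perm (Fin n)) (a b : Fin n) :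
    s2perm σ s(a, b) = s(σ a, σ b) := rfl

lemma inducedCount_perm {β : Type*} [Fintype β] (H : SimpleGraph β) {n : ℕ}
    (x : Sym2 (Fin n) → Bool) (σ : Equiv.Perm (Fin n)) :
    inducedCount H (graphOfFn (x ∘ s2perm σ)) = inducedCount H (graphOfFn x) := by
  apply inducedCount_iso
  refine ⟨σ, ?_⟩
  intro a b
  simp [graphOfFn_adj]

lemma chi_perm {n : ℕ} (p : ℝ) (e : Sym2 (Fin n)) (x : Sym2 (Fin n) → Bool)
    (τ : Equiv.Perm (Sym2 (Fin n))) : chiMono p {e} (x ∘ τ) = chiMono p {τ e} x := by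
  simp [chiMono]

lemma coeff_const {β : Type*} [Fintype β] (H : SimpleGraph β) {n : ℕ} (p : ℝ)
    (e e' : Sym2 (Fin n)) (he : ¬ e.IsDiag) (he' : ¬ e'.IsDiag) :
    ∫ y, (inducedCount H (graphOfFn y) : ℝ) * chiMono p {e} y ∂(gnp n p) =
    ∫ y, (inducedCount H (graphOfFn y) : ℝ) * chiMono p {e'} y ∂(gnp n p) := by
  classical
  obtain ⟨σ, hσ⟩ : ∃ σ : Equiv.Perm (Fin n), s2perm σ e = e' := by
    induction e using Sym2.inductionOn with
    | _ a b =>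
    induction e' using Sym2.inductionOn with
    | _ c d =>
    simp at he he'
    refine ⟨(Equiv.swap a c).trans (Equiv.swap (Equiv.swap a c b) d), ?_⟩
    have h1 : Equiv.swap (Equiv.swap a c b) d c = c := by
      apply Equiv.swap_apply_of_ne_of_ne
      · intro h
        rw [← Equiv.swap_apply_left a c] at h
        exact he ((Equiv.swap a c).injective (by simpa using h))
      · exact he'
    simp [h1]
  rw [← int_gnp_perm n p _ (s2perm σ)]
  simp_rw [inducedCount_perm, chi_perm, hσ]

lemma order0 {n : ℕ} (p : ℝ) (F : (Sym2 (Fin n) → Bool) → ℝ) (x y : Sym2 (Fin n) → Bool) :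
    orderPart p 0 F x = orderPart p 0 F y := by
  classical
  unfold orderPart
  refine Finset.sum_congr rfl fun E _ => ?_
  split_ifs with h
  · have : E = ∅ := by
      rw [Finset.eq_empty_iff_forall_notMem]
      intro e he
      have h2 := Finset.card_eq_zero.1 h.2
      induction e using Sym2.inductionOn with
      | _ a b =>
      have : a ∈ (∅ : Finset (Fin n)) := by
        rw [← h2]
        simp only [Finset.mem_filter, Finset.mem_univ, true_and]
        exact ⟨_, he, by simp⟩
      simp at this
    subst this
    simp [chiMono]
  · rfl

lemma span_two {n : ℕ} [DecidableEq (Fin n)] (E : Finset (Sym2 (Fin n)))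
    (hd : DecidablePred fun v : Fin n => ∃ e ∈ E, v ∈ e) :
    ((∀ e ∈ E, ¬ e.IsDiag) ∧
        (Finset.univ.filter fun v : Fin n => ∃ e ∈ E, v ∈ e).card = 2) ↔
      ∃ e : Sym2 (Fin n), ¬ e.IsDiag ∧ {e} = E := by
  constructor
  · rintro ⟨h1, h2⟩
    obtain ⟨a, b, hab, h⟩ := Finset.card_eq_two.1 h2
    have hm : ∀ v : Fin n, (∃ e ∈ E, v ∈ e) ↔ v = a ∨ v = b := by
      intro v
      have : v ∈ (Finset.univ.filter fun v : Fin n => ∃ e ∈ E, v ∈ e) ↔ v ∈ ({a, b} : Finset (Fin n)) := by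
        rw [h]
      simpa using this
    have hE : ∀ e ∈ E, e = s(a, b) := by
      intro e he
      have hnd := h1 e he
      induction e using Sym2.inductionOn with
      | _ c d =>
      have hc := (hm c).1 ⟨_, he, by simp⟩
      have hd := (hm d).1 ⟨_, he, by simp⟩
      simp at hnd
      rcases hc with rfl | rfl <;> rcases hd with rfl | rfl <;> simp_all
    refine ⟨s(a, b), by simpa using hab, ?_⟩
    obtain ⟨e, he, -⟩ := (hm a).2 (Or.inl rfl)
    ext f
    simp only [Finset.mem_singleton]
    constructor
    · rintro rfl; rwa [← hE e he]
    · exact hE f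
  · rintro ⟨e, he, rfl⟩
    refine ⟨by simpa using he, ?_⟩
    induction e using Sym2.inductionOn with
    | _ a b =>
    simp at he
    rw [← Finset.card_pair he]
    congr 1
    ext v; simp

lemma order2 {β : Type*} [Fintype β] (H : SimpleGraph β) {n m : ℕ} (hM : 0 < n.choose 2)
    (x : Sym2 (Fin n) → Bool) (hx : x ∈ SS n m) :
    orderPart ((m : ℝ) / (n.choose 2)) 2
      (fun x : Sym2 (Fin n) → Bool => (inducedCount H (graphOfFn x) : ℝ)) x = 0 := by
  classical
  set p : ℝ := (m : ℝ) / (n.choose 2) with hp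
  set ND := (Finset.univ.filter fun e : Sym2 (Fin n) => ¬ e.IsDiag) with hND
  set a : Finset (Sym2 (Fin n)) → ℝ := fun E =>
    ∫ y, (inducedCount H (graphOfFn y) : ℝ) * chiMono p E y ∂(gnp n p) with ha
  have h1 : orderPart p 2 (fun x : Sym2 (Fin n) → Bool => (inducedCount H (graphOfFn x) : ℝ)) x =
      ∑ e ∈ ND, a {e} * chiMono p {e} x := by
    unfold orderPart
    rw [← Finset.sum_filter]
    have : (Finset.univ.filter fun E : Finset (Sym2 (Fin n)) => (∀ e ∈ E, ¬ e.IsDiag) ∧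
        (Finset.univ.filter fun v : Fin n => ∃ e ∈ E, v ∈ e).card = 2) =
        ND.map ⟨fun e => {e}, Finset.singleton_injective⟩ := by
      ext E
      rw [Finset.mem_filter, Finset.mem_map]
      have := span_two E inferInstance
      simp only [Finset.mem_univ, true_and, hND, Finset.mem_filter, Function.Embedding.coeFn_mk]
      convert this
    convert Finset.sum_map ND ⟨fun e => {e}, Finset.singleton_injective⟩
      (fun E => a E * chiMono p E x) using 1
    rw [← this]
    refine Finset.sum_congr ?_ fun _ _ => rfl
    ext E
    simp only [Finset.mem_filter]
  rw [h1]
  have hsum : ∑ e ∈ ND, chiMono p {e} x = 0 := by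
    simp only [chiMono, Finset.prod_singleton]
    rw [← Finset.sum_div, Finset.sum_sub_distrib, Finset.sum_const, Finset.sum_boole]
    have hc : (ND.filter fun e => x e = true) = Finset.univ.filter fun e : Sym2 (Fin n) => x e = true := by
      ext e
      simp only [hND, Finset.mem_filter, Finset.mem_univ, true_and, and_iff_right_iff_imp]
      intro h hd
      rw [(mem_SS.1 hx).1 e hd] at h
      exact absurd h (by simp)
    rw [hc, (mem_SS.1 hx).2, hND, card_nondiag, nsmul_eq_mul, hp]
    have : (n.choose 2 : ℝ) ≠ 0 := by exact_mod_cast hM.ne'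
    field_simp
    simp
  rcases ND.eq_empty_or_nonempty with h | ⟨e0, he0⟩
  · rw [h]; simp
  · have : ∀ e ∈ ND, a {e} * chiMono p {e} x = a {e0} * chiMono p {e} x := by
      intro e he
      congr 1
      exact coeff_const H p e e0 (by simpa [hND] using he) (by simpa [hND] using he0)
    rw [Finset.sum_congr rfl this, ← Finset.mul_sum, hsum, mul_zero]

lemma exists_BD {β : Type*} [Fintype β] (H : SimpleGraph β) (n N k : ℕ)
    (hk : Fintype.card β = k + 2) (hN : N * (3 * k + 4) ≤ n) : Nonempty (BD H n N k) := by
  classical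
  have hne : Nonempty β := Fintype.card_pos_iff.1 (by omega)
  obtain ⟨ι⟩ : Nonempty (Fin N × (β ⊕ (Fin (k+1) × Bool)) ↪ Fin n) := by
    apply Function.Embedding.nonempty_of_card_le
    simp [hk]
    refine le_trans (le_of_eq ?_) hN
    ring
  rcases SimpleGraph.connected_or_connected_compl H with hT | hT
  · obtain ⟨r, ver, par, rank, h1, h2, h3, h4⟩ := tree_data H hT k hk
    exact ⟨⟨r, ver, par, rank, h1, h2, h3, fun b hb => (h4 b hb).2, true,
      fun b hb => by simp [(h4 b hb).1], ι⟩⟩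
  · obtain ⟨r, ver, par, rank, h1, h2, h3, h4⟩ := tree_data Hᶜ hT k hk
    exact ⟨⟨r, ver, par, rank, h1, h2, h3, fun b hb => (h4 b hb).2, false,
      fun b hb => by simpa using ((SimpleGraph.compl_adj _ _ _).1 (h4 b hb).1).2, ι⟩⟩

lemma final_num (a D L u x N n M s : ℝ) (ha : 0 < a) (hD : 0 < D) (hL : 0 < L)
    (hu : u = a / (2 * L)) (hn : 0 ≤ n) (hM : M ≤ n ^ 2) (hN : n ≤ L * (N + 1))
    (hs : |s| ≤ Real.pi) :
    (M + 1) * Real.exp (- (a * N)) + Real.exp (- (s ^ 2 * (a * N) / D)) ≤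
      (Real.exp a * (2 / u ^ 2 + 1) + Real.exp (Real.pi ^ 2 * a / D)) *
        (Real.exp (-(min u (a / (L * D)) * n)) + Real.exp (-(min u (a / (L * D)) * s ^ 2 * n))) := by
  have hu0 : 0 < u := by rw [hu]; positivity
  set c := min u (a / (L * D)) with hc
  have hc1 : c ≤ u := min_le_left _ _
  have hc2 : c ≤ a / (L * D) := min_le_right _ _
  have hNn : n / L - 1 ≤ N := by
    rw [sub_le_iff_le_add, div_le_iff₀ hL]; linarith
  have hs2 : s ^ 2 ≤ Real.pi ^ 2 := by
    rw [← sq_abs s]; exact pow_le_pow_left₀ (abs_nonneg _) hs 2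
  have e1 : (M + 1) * Real.exp (- (a * N)) ≤
      Real.exp a * (2 / u ^ 2 + 1) * Real.exp (-(c * n)) := by
    have g1 : Real.exp (-(a * N)) ≤ Real.exp a * (Real.exp (-(u * n)) * Real.exp (-(u * n))) := by
      rw [← Real.exp_add, ← Real.exp_add]
      apply Real.exp_le_exp.2
      have : a * (n / L - 1) ≤ a * N := mul_le_mul_of_nonneg_left hNn ha.le
      have h2 : u * n + u * n = a * (n / L) := by rw [hu]; field_simp; ring
      linarith
    have g2 : (n ^ 2 + 1) * Real.exp (-(u * n)) ≤ 2 / u ^ 2 + 1 := by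
      have q := Real.quadratic_le_exp_of_nonneg (x := u * n) (by positivity)
      rw [Real.exp_neg, ← div_eq_mul_inv, div_le_iff₀ (Real.exp_pos _)]
      have hun : 0 ≤ u * n := by positivity
      have h3 : n ^ 2 = 2 / u ^ 2 * ((u * n) ^ 2 / 2) := by field_simp
      have h4 : 2 / u ^ 2 * ((u * n) ^ 2 / 2) ≤ 2 / u ^ 2 * Real.exp (u * n) :=
        mul_le_mul_of_nonneg_left (by linarith) (by positivity)
      have h5 : 1 ≤ Real.exp (u * n) := Real.one_le_exp hun
      rw [h3]; linarith
    have g3 : Real.exp (-(u * n)) ≤ Real.exp (-(c * n)) := by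
      apply Real.exp_le_exp.2
      have := mul_le_mul_of_nonneg_right hc1 hn
      linarith
    calc (M + 1) * Real.exp (- (a * N))
        ≤ (n ^ 2 + 1) * (Real.exp a * (Real.exp (-(u * n)) * Real.exp (-(u * n)))) := by
          gcongr
      _ = Real.exp a * ((n ^ 2 + 1) * Real.exp (-(u * n))) * Real.exp (-(u * n)) := by ring
      _ ≤ _ := by gcongr
  have e2 : Real.exp (- (s ^ 2 * (a * N) / D)) ≤
      Real.exp (Real.pi ^ 2 * a / D) * Real.exp (-(c * s ^ 2 * n)) := by
    rw [← Real.exp_add]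
    apply Real.exp_le_exp.2
    have h1 : s ^ 2 * (a * (n / L - 1)) / D ≤ s ^ 2 * (a * N) / D := by gcongr
    have h2 : s ^ 2 * (a * (n / L - 1)) / D = a / (L * D) * (s ^ 2 * n) - s ^ 2 * a / D := by
      field_simp
    have h3 : s ^ 2 * a / D ≤ Real.pi ^ 2 * a / D := by gcongr
    have h4 : c * (s ^ 2 * n) ≤ a / (L * D) * (s ^ 2 * n) :=
      mul_le_mul_of_nonneg_right hc2 (by positivity)
    linarith
  have p1 : 0 ≤ Real.exp a * (2 / u ^ 2 + 1) * Real.exp (-(c * s ^ 2 * n)) := by positivity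
  have p2 : 0 ≤ Real.exp (Real.pi ^ 2 * a / D) * Real.exp (-(c * n)) := by positivity
  nlinarith

end ICF

theorem induced_count_char_fun_top_range
    {β : Type*} [Fintype β] (H : SimpleGraph β)
    (hcard : 3 ≤ Fintype.card β)
    (lam : ℝ) (hlam : lam ∈ Set.Ioo (0 : ℝ) (1 / 2)) :
    ∃ Pcrit : Finset ℝ, (↑Pcrit : Set ℝ) ⊆ Set.Ioo (0 : ℝ) 1 ∧
      Pcrit.card ≤ Fintype.card β ^ 2 ∧
      ∃ c C : ℝ, 0 < c ∧ 0 < C ∧ ∀ n : ℕ, Fintype.card β ≤ n → ∀ m : ℕ,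
        (m : ℝ) / (n.choose 2) ∈ Set.Ioo lam (1 - lam) →
        (∀ q ∈ Pcrit, lam ≤ |(m : ℝ) / (n.choose 2) - q|) →
        let p : ℝ := (m : ℝ) / (n.choose 2)
        let F : (Sym2 (Fin n) → Bool) → ℝ := fun x => (inducedCount H (graphOfFn x) : ℝ)
        let σ := Real.sqrt (∫ x, (orderPart p 3 F x -
          ∫ y, orderPart p 3 F y ∂(gnp n p)) ^ 2 ∂(gnp n p))
        let K : (Sym2 (Fin n) → Bool) → ℝ := fun x =>
          (F x - orderPart p 0 F x - orderPart p 2 F x) / σ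
        ∀ t : ℝ, |t| ≤ Real.pi * σ →
          ‖∫ x, Complex.exp (Complex.I * Complex.ofReal (t * K x)) ∂(gnm n m)‖
            ≤ C * (Real.exp (-(c * n)) + Real.exp (-(c * t ^ 2 * n / σ ^ 2))) := by
  classical
  obtain ⟨hl0, hl1⟩ := hlam
  obtain ⟨k, hk⟩ : ∃ k, Fintype.card β = k + 2 := ⟨Fintype.card β - 2, by omega⟩
  have hk1 : 1 ≤ k := by omega
  set q : ℝ := lam ^ (Fintype.card β ^ 2 + (k + 1)) with hq
  have hq0 : 0 < q := by positivity
  set a : ℝ := q / 4 with ha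
  have ha0 : 0 < a := by positivity
  set D : ℝ := Real.pi ^ 2 * 4 ^ (k+1) * 2 ^ (k+1) with hD
  have hD0 : 0 < D := by have := Real.pi_pos; positivity
  set Lr : ℝ := ((3 * k + 4 : ℕ) : ℝ) with hLr
  have hL0 : 0 < Lr := by rw [hLr]; positivity
  set u : ℝ := a / (2 * Lr) with hu
  have hu0 : 0 < u := by positivity
  refine ⟨∅, by simp, by simp, min u (a / (Lr * D)),
    Real.exp a * (2 / u ^ 2 + 1) + Real.exp (Real.pi ^ 2 * a / D), ?_, by positivity, ?_⟩
  · exact lt_min hu0 (by positivity)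
  intro n hn m hp _ p F σ K t ht
  have hM : 0 < n.choose 2 := Nat.choose_pos (by omega)
  set N := n / (3 * k + 4) with hN
  obtain ⟨B⟩ := ICF.exists_BD H n N k hk (Nat.div_mul_le_self _ _)
  have hNn : (n : ℝ) ≤ Lr * ((N : ℝ) + 1) := by
    have : n < (3 * k + 4) * (n / (3 * k + 4) + 1) := Nat.lt_mul_div_succ n (by omega)
    rw [hLr, hN]
    exact_mod_cast this.le
  have hMn : (n.choose 2 : ℝ) ≤ (n : ℝ) ^ 2 := by exact_mod_cast Nat.choose_le_pow n 2
  have hσ0 : 0 ≤ σ := Real.sqrt_nonneg _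
  set s := t / σ with hs
  have hsπ : |s| ≤ Real.pi := by
    rw [hs, abs_div, abs_of_nonneg hσ0]
    exact div_le_of_le_mul₀ hσ0 Real.pi_pos.le ht
  have hmain := B.main_bound hk hk1 m hM lam hl0 hp q hq s hsπ
  have hfin := ICF.final_num a D Lr u 0 N n (n.choose 2) s ha0 hD0 hL0 hu (by positivity) hMn hNn hsπ
  have hexp : min u (a / (Lr * D)) * t ^ 2 * n / σ ^ 2 = min u (a / (Lr * D)) * s ^ 2 * n := by
    rw [hs, div_pow]; ring
  rw [hexp]
  refine le_trans ?_ hfin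
  set w0 := orderPart p 0 F (fun _ => false) with hw0
  have hval : ∀ x ∈ ICF.SS n m, Complex.exp (Complex.I * Complex.ofReal (t * K x)) =
      ICF.ex (-(s * w0)) * ICF.ex (s * (inducedCount H (graphOfFn x) : ℝ)) := by
    intro x hx
    have h2 : orderPart p 2 F x = 0 := ICF.order2 H hM x hx
    have h0 : orderPart p 0 F x = w0 := ICF.order0 p F x _
    have hK : t * K x = -(s * w0) + s * F x := by
      simp only [K, h2, h0, hs]
      ring
    rw [hK, ← ICF.ex_add, ICF.ex, mul_comm Complex.I]
  rw [ICF.int_gnm, Finset.sum_congr rfl hval, ← Finset.mul_sum, norm_mul, norm_mul, ICF.norm_ex, one_mul,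
    norm_inv, Complex.norm_natCast]
  refine (mul_le_mul_of_nonneg_left hmain (by positivity)).trans ?_
  rw [mul_comm, mul_assoc]
  refine mul_le_of_le_one_right (by positivity) ?_
  exact mul_inv_le_one
end
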